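/- arXiv:1711.09244 — 3 statements merged into one kernel-verified Lean document; each statement's English description precedes it below -/
import Mathlib

section
/- There is no universal operator for the complement of the class of strictly singular operators: there does not exist a bounded operator U between real Banach spaces such that U is not strictly singular and U factors through every operator between Banach spaces that is not strictly singular. -/
/-!
STATEMENT 4: There is no universal operator for the complement of the class of strictly
singular operators: there is no bounded operator `U` between real Banach spaces such that
`U` is not strictly singular and `U` factors through every operator between Banach spaces
that is not strictly singular.
-/

/-- A bundled real Banach space. -/
structure BanachSp : Type 1 where
  carrier : Type
  [nacg : NormedAddCommGroup carrier]
  [nsp : NormedSpace ℝ carrier]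
  [cs : CompleteSpace carrier]

attribute [instance] BanachSp.nacg BanachSp.nsp BanachSp.cs

/-- `A` factors through `B`: there are bounded operators `C`, `D` with `A = D ∘ B ∘ C`. -/
def FactorsThrough {X Y Z W : Type*} [NormedAddCommGroup X] [NormedSpace ℝ X]
    [NormedAddCommGroup Y] [NormedSpace ℝ Y] [NormedAddCommGroup Z] [NormedSpace ℝ Z]
    [NormedAddCommGroup W] [NormedSpace ℝ W]
    (A : X →L[ℝ] Y) (B : Z →L[ℝ] W) : Prop :=
  ∃ (C : X →L[ℝ] Z) (D : W →L[ℝ] Y), ∀ x, D (B (C x)) = A x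

/-- An operator is strictly singular if its restriction to every infinite-dimensional
closed subspace fails to be an isomorphic embedding. -/
def StrictlySingular {X Y : Type*} [NormedAddCommGroup X] [NormedSpace ℝ X]
    [NormedAddCommGroup Y] [NormedSpace ℝ Y] (A : X →L[ℝ] Y) : Prop :=
  ∀ Z : Submodule ℝ X, IsClosed (Z : Set X) → ¬ FiniteDimensional ℝ Z →
    ¬ ∃ δ : ℝ, 0 < δ ∧ ∀ z ∈ Z, δ * ‖z‖ ≤ ‖A z‖

open scoped ZeroAtInfty InnerProductSpace

/-- A real vector space with an infinite biorthogonal system is infinite-dimensional. -/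
theorem not_finiteDimensional_of_biorthogonal {E : Type*} [AddCommGroup E] [Module ℝ E]
    (φ : E →ₗ[ℝ] ℕ → ℝ) (v : ℕ → E) (h : ∀ n, φ (v n) = Pi.single n 1) :
    ¬ FiniteDimensional ℝ E := by
  intro hE
  have hv : LinearIndependent ℝ v := by
    apply LinearIndependent.of_comp φ
    have : φ ∘ v = fun n => Pi.single n 1 := funext h
    rw [this]
    exact Pi.linearIndependent_single_one ℕ ℝ
  exact not_finite_iff_infinite.mpr inferInstance hv.finite

/-- The space `ℓ²` is infinite-dimensional. -/
theorem not_finiteDimensional_lp_two :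
    ¬ FiniteDimensional ℝ (lp (fun _ : ℕ => ℝ) 2) :=
  not_finiteDimensional_of_biorthogonal
    { toFun := fun f => f
      map_add' := fun _ _ => rfl
      map_smul' := fun _ _ => rfl }
    (fun n => lp.single 2 n (1 : ℝ)) fun n => lp.coeFn_single 2 n 1

/-- The space `c₀` is infinite-dimensional. -/
theorem not_finiteDimensional_zeroAtInfty : ¬ FiniteDimensional ℝ C₀(ℕ, ℝ) :=
  not_finiteDimensional_of_biorthogonal
    { toFun := fun f => f
      map_add' := fun _ _ => rfl
      map_smul' := fun _ _ => rfl }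
    (fun n =>
      { toFun := Pi.single n 1
        continuous_toFun := continuous_of_discreteTopology
        zero_at_infty' := by
          rw [Filter.cocompact_eq_cofinite, Nat.cofinite_eq_atTop]
          refine tendsto_const_nhds.congr' ?_
          filter_upwards [Filter.eventually_gt_atTop n] with m hm
          simp [hm.ne'] }) fun n => rfl

theorem ZeroAtInftyContinuousMap.norm_le_of_forall {f : C₀(ℕ, ℝ)} {r : ℝ} (hr : 0 ≤ r)
    (h : ∀ n, |f n| ≤ r) : ‖f‖ ≤ r := by
  rw [← ZeroAtInftyContinuousMap.norm_toBCF_eq_norm]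
  exact (BoundedContinuousFunction.norm_le hr).2 h

theorem ZeroAtInftyContinuousMap.abs_apply_le_norm (f : C₀(ℕ, ℝ)) (n : ℕ) : |f n| ≤ ‖f‖ := by
  rw [← ZeroAtInftyContinuousMap.norm_toBCF_eq_norm]
  exact f.toBCF.norm_coe_le_norm n

/-- If an injective map `T` into `c₀` and a map `S` into an inner product space induce equivalent
norms on a vector space, then this space is finite-dimensional. -/
theorem finiteDimensional_of_equivalent_norms {V H : Type*} [AddCommGroup V] [Module ℝ V]
    [NormedAddCommGroup H] [InnerProductSpace ℝ H] (S : V →ₗ[ℝ] H) (T : V →ₗ[ℝ] C₀(ℕ, ℝ))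
    (hT : Function.Injective T) {c C : ℝ} (hc : 0 < c) (hcS : ∀ v, c * ‖T v‖ ≤ ‖S v‖)
    (hSC : ∀ v, ‖S v‖ ≤ C * ‖T v‖) : FiniteDimensional ℝ V := by
  by_contra hV
  -- Gliding hump: add a vector orthogonal under `S` and supported far away under `T`.
  have step (s : V) (hs : ‖T s‖ ≤ 2) : ∃ t, ‖T t‖ ≤ 2 ∧ ‖S s‖ ^ 2 + c ^ 2 ≤ ‖S t‖ ^ 2 := by
    have hlim : Filter.Tendsto (T s) Filter.atTop (nhds 0) := by
      have := zero_at_infty (T s)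
      rwa [Filter.cocompact_eq_cofinite, Nat.cofinite_eq_atTop] at this
    obtain ⟨n, hn⟩ := Metric.tendsto_atTop.1 hlim 1 one_pos
    let φ : V →ₗ[ℝ] (Fin n → ℝ) × ℝ :=
      { toFun := fun v => (fun i => T v i, ⟪S s, S v⟫_ℝ)
        map_add' := fun v w => by ext <;> simp [inner_add_right]
        map_smul' := fun a v => by ext <;> simp [inner_smul_right] }
    obtain ⟨w, hw, hw0⟩ : ∃ w, φ w = 0 ∧ w ≠ 0 := by
      by_contra! h
      exact hV (Module.Finite.of_injective φ ((injective_iff_map_eq_zero φ).2 h))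
    have hTw : ‖T w‖ ≠ 0 := by
      rw [norm_ne_zero_iff]
      exact (map_ne_zero_iff T hT).2 hw0
    obtain ⟨z, hz, hz1⟩ : ∃ z, φ z = 0 ∧ ‖T z‖ = 1 :=
      ⟨‖T w‖⁻¹ • w, by simp [hw], by simp [norm_smul, hTw]⟩
    have hz_coord (i : ℕ) (hi : i < n) : T z i = 0 := congrFun (congrArg Prod.fst hz) ⟨i, hi⟩
    have hz_inner : ⟪S s, S z⟫_ℝ = 0 := congrArg Prod.snd hz
    refine ⟨s + z, ZeroAtInftyContinuousMap.norm_le_of_forall zero_le_two fun i => ?_, ?_⟩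
    · rw [map_add, ZeroAtInftyContinuousMap.add_apply]
      rcases lt_or_ge i n with hi | hi
      · rw [hz_coord i hi, add_zero]
        exact ((T s).abs_apply_le_norm i).trans hs
      · have h1 := hn i hi
        rw [dist_zero_right, Real.norm_eq_abs] at h1
        have h2 := (T z).abs_apply_le_norm i
        have h3 := abs_add_le (T s i) (T z i)
        linarith
    · have h1 := hcS z
      rw [hz1, mul_one] at h1
      rw [map_add, norm_add_sq_real, hz_inner]
      have := pow_le_pow_left₀ hc.le h1 2
      linarith
  have grow (N : ℕ) : ∃ s, ‖T s‖ ≤ 2 ∧ N * c ^ 2 ≤ ‖S s‖ ^ 2 := by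
    induction N with
    | zero => exact ⟨0, by simp, by simp⟩
    | succ N ih =>
      obtain ⟨s, hs, hsN⟩ := ih
      obtain ⟨t, ht, hst⟩ := step s hs
      refine ⟨t, ht, ?_⟩
      push_cast
      linarith
  obtain ⟨N, hN⟩ := exists_nat_gt ((|C| * 2) ^ 2 / c ^ 2)
  obtain ⟨s, hs, hsN⟩ := grow N
  rw [div_lt_iff₀ (by positivity)] at hN
  have h1 : ‖S s‖ ≤ |C| * 2 :=
    (hSC s).trans (mul_le_mul (le_abs_self C) hs (norm_nonneg _) (abs_nonneg C))
  have h2 := pow_le_pow_left₀ (norm_nonneg _) h1 2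
  linarith

/-- The identity of an infinite-dimensional space is not strictly singular. -/
theorem not_strictlySingular_id {X : Type*} [NormedAddCommGroup X] [NormedSpace ℝ X]
    (hX : ¬ FiniteDimensional ℝ X) : ¬ StrictlySingular (ContinuousLinearMap.id ℝ X) := by
  intro h
  refine h ⊤ isClosed_univ (fun hfin => hX ?_) ⟨1, one_pos, fun z _ => by simp⟩
  exact Module.Finite.equiv (Submodule.topEquiv (R := ℝ) (M := X))

/-- If `U` is bounded below on `Z` and factors through the identity of `X`, then some bounded
operator into `X` is bounded below on `Z`. -/
theorem FactorsThrough.exists_bounded_below {E F X : Type*} [NormedAddCommGroup E]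
    [NormedSpace ℝ E] [NormedAddCommGroup F] [NormedSpace ℝ F] [NormedAddCommGroup X]
    [NormedSpace ℝ X] {U : E →L[ℝ] F} (hU : FactorsThrough U (ContinuousLinearMap.id ℝ X))
    {Z : Submodule ℝ E} {δ : ℝ} (hδ : 0 < δ) (hZ : ∀ z ∈ Z, δ * ‖z‖ ≤ ‖U z‖) :
    ∃ (S : E →L[ℝ] X) (K : ℝ), 0 < K ∧ ∀ z ∈ Z, ‖z‖ ≤ K * ‖S z‖ := by
  obtain ⟨S, D, hSD⟩ := hU
  refine ⟨S, (‖D‖ + 1) / δ, by positivity, fun z hz => ?_⟩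
  have h1 := hZ z hz
  rw [← hSD z] at h1
  have h2 : ‖D (S z)‖ ≤ ‖D‖ * ‖S z‖ := D.le_opNorm _
  rw [div_mul_eq_mul_div, le_div_iff₀ hδ]
  have h3 := norm_nonneg (S z)
  simp only [ContinuousLinearMap.id_apply] at h1
  linarith

theorem statement4 :
    ¬ ∃ (E F : BanachSp) (U : E.carrier →L[ℝ] F.carrier),
      ¬ StrictlySingular U ∧
        ∀ (Z W : BanachSp) (T : Z.carrier →L[ℝ] W.carrier),
          ¬ StrictlySingular T → FactorsThrough U T := by
  rintro ⟨E, F, U, hU, hfac⟩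
  simp only [StrictlySingular, not_forall, not_not] at hU
  obtain ⟨Z, -, hZ, δ, hδ, hδU⟩ := hU
  obtain ⟨S, K, hK, hS⟩ := (hfac ⟨lp (fun _ : ℕ => ℝ) 2⟩ ⟨lp (fun _ : ℕ => ℝ) 2⟩ _
    (not_strictlySingular_id not_finiteDimensional_lp_two)).exists_bounded_below hδ hδU
  obtain ⟨T, L, hL, hT⟩ := (hfac ⟨C₀(ℕ, ℝ)⟩ ⟨C₀(ℕ, ℝ)⟩ _
    (not_strictlySingular_id not_finiteDimensional_zeroAtInfty)).exists_bounded_below hδ hδU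
  refine hZ (finiteDimensional_of_equivalent_norms (S.toLinearMap ∘ₗ Z.subtype)
    (T.toLinearMap ∘ₗ Z.subtype) ?_ (c := ((‖T‖ + 1) * K)⁻¹) (C := ‖S‖ * L) (by positivity)
    (fun v => ?_) fun v => ?_)
  · refine (injective_iff_map_eq_zero _).2 fun v hv => ?_
    have h1 := hT v v.2
    have h2 : T v = 0 := hv
    rw [h2, norm_zero, mul_zero] at h1
    exact Subtype.ext (norm_le_zero_iff.1 h1)
  · change ((‖T‖ + 1) * K)⁻¹ * ‖T v‖ ≤ ‖S v‖
    rw [inv_mul_le_iff₀ (by positivity)]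
    calc ‖T v‖ ≤ ‖T‖ * ‖(v : E.carrier)‖ := T.le_opNorm _
      _ ≤ (‖T‖ + 1) * (K * ‖S v‖) := by
        gcongr
        · linarith
        · exact hS v v.2
      _ = (‖T‖ + 1) * K * ‖S v‖ := by ring
  · change ‖S v‖ ≤ ‖S‖ * L * ‖T v‖
    calc ‖S v‖ ≤ ‖S‖ * ‖(v : E.carrier)‖ := S.le_opNorm _
      _ ≤ ‖S‖ * (L * ‖T v‖) := by
        gcongr
        exact hT v v.2
      _ = ‖S‖ * L * ‖T v‖ := by ring
end

section
/- There is no universal operator for the complement of the class of completely continuous operators: there does not exist a bounded operator U between real Banach spaces such that U is not completely continuous and U factors through every operator between Banach spaces that is not completely continuous. -/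
/-!
STATEMENT 7: There is no universal operator for the complement of the class of completely
continuous operators: there is no bounded operator `U` between real Banach spaces such
that `U` is not completely continuous and `U` factors through every operator between
Banach spaces that is not completely continuous.
-/

open Filter

/-- A sequence is weakly null if every continuous linear functional sends it to a null
sequence. -/
def WeaklyNull {X : Type*} [NormedAddCommGroup X] [NormedSpace ℝ X] (x : ℕ → X) : Prop :=
  ∀ f : X →L[ℝ] ℝ, Tendsto (fun n => f (x n)) atTop (nhds 0)

/-- An operator `A : X → Y` is completely continuous if it sends every weakly null
sequence of the closed unit ball of `X` to a norm null sequence. -/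
def CompletelyContinuous {X Y : Type*} [NormedAddCommGroup X] [NormedSpace ℝ X]
    [NormedAddCommGroup Y] [NormedSpace ℝ Y] (A : X →L[ℝ] Y) : Prop :=
  ∀ x : ℕ → X, (∀ n, ‖x n‖ ≤ 1) → WeaklyNull x →
    Tendsto (fun n => ‖A (x n)‖) atTop (nhds 0)

section FlatFamilies

/-- Finitely supported nonnegative vectors, vanishing below `i`, all of whose sums along
increasing lists are at most one. -/
def subprobTail (i : ℕ) : Set (ℕ →₀ ℝ) :=
  {a | (∀ n, 0 ≤ a n) ∧ (∀ l : List ℕ, l.Pairwise (· < ·) → (l.map a).sum ≤ 1) ∧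
    ∀ n < i, a n = 0}

/-- Vectors whose sums along the members of the family `F` are at most `ε`. -/
def smallOn (F : Set (List ℕ)) (ε : ℝ) : Set (ℕ →₀ ℝ) :=
  {a | ∀ l ∈ F, (l.map a).sum ≤ ε}

/-- A family of lists is flat if every sequence of subprobability vectors with supports
tending to infinity has convex combinations that are uniformly small on the family. -/
def IsFlat (F : Set (List ℕ)) : Prop :=
  ∀ u : ℕ → ℕ →₀ ℝ, (∀ i, u i ∈ subprobTail i) → ∀ ε > 0,
    ∃ a ∈ convexHull ℝ (Set.range u), a ∈ smallOn F ε

theorem list_sum_map_combo (l : List ℕ) (s t : ℝ) (a b : ℕ → ℝ) :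
    (l.map fun n => s * a n + t * b n).sum = s * (l.map a).sum + t * (l.map b).sum := by
  induction l with
  | nil => simp
  | cons n l ih => simp only [List.map_cons, List.sum_cons, ih]; ring

theorem convex_smallOn (F : Set (List ℕ)) (ε : ℝ) : Convex ℝ (smallOn F ε) := by
  intro a ha b hb s t hs ht hst l hl
  have h := list_sum_map_combo l s t a b
  have h' : (l.map (s • a + t • b : ℕ →₀ ℝ)).sum = s * (l.map a).sum + t * (l.map b).sum := by
    rw [← h]; congr 1
  rw [h']
  have h1 := mul_le_mul_of_nonneg_left (ha l hl) hs
  have h2 := mul_le_mul_of_nonneg_left (hb l hl) ht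
  have h3 : s * ε + t * ε = ε := by rw [← add_mul, hst, one_mul]
  linarith

theorem convex_subprobTail (i : ℕ) : Convex ℝ (subprobTail i) := by
  intro a ha b hb s t hs ht hst
  refine ⟨fun n => ?_, ?_, fun n hn => ?_⟩
  · have := mul_nonneg hs (ha.1 n)
    have := mul_nonneg ht (hb.1 n)
    simp only [Finsupp.add_apply, Finsupp.smul_apply, smul_eq_mul]
    linarith
  · exact convex_smallOn {l | l.Pairwise (· < ·)} 1 ha.2.1 hb.2.1 hs ht hst
  · simp [ha.2.2 n hn, hb.2.2 n hn]

theorem subprobTail_antitone : Antitone subprobTail :=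
  fun _ _ hij _ ha => ⟨ha.1, ha.2.1, fun n hn => ha.2.2 n (hn.trans_le hij)⟩

theorem IsFlat.exists_tail {F : Set (List ℕ)} (hF : IsFlat F) {u : ℕ → ℕ →₀ ℝ}
    (hu : ∀ i, u i ∈ subprobTail i) {ε : ℝ} (hε : 0 < ε) (m : ℕ) :
    ∃ a ∈ convexHull ℝ (Set.range u), a ∈ subprobTail m ∧ a ∈ smallOn F ε := by
  obtain ⟨a, ha, has⟩ := hF (fun i => u (i + m))
    (fun i => subprobTail_antitone (Nat.le_add_right i m) (hu _)) ε hε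
  refine ⟨a, convexHull_mono ?_ ha, convexHull_min ?_ (convex_subprobTail m) ha, has⟩
  · rintro _ ⟨i, rfl⟩
    exact ⟨_, rfl⟩
  · rintro _ ⟨i, rfl⟩
    exact subprobTail_antitone (Nat.le_add_left m i) (hu _)

theorem isFlat_empty : IsFlat ∅ :=
  fun u _ _ _ => ⟨u 0, subset_convexHull _ _ ⟨0, rfl⟩, fun _ hl => hl.elim⟩

theorem IsFlat.union {F G : Set (List ℕ)} (hF : IsFlat F) (hG : IsFlat G) :
    IsFlat (F ∪ G) := by
  intro u hu ε hε
  choose v hv hvt hvs using fun m => hF.exists_tail hu hε m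
  obtain ⟨a, ha, has⟩ := hG v hvt ε hε
  have hvu : Set.range v ⊆ convexHull ℝ (Set.range u) := by rintro _ ⟨i, rfl⟩; exact hv i
  have hvF : Set.range v ⊆ smallOn F ε := by rintro _ ⟨i, rfl⟩; exact hvs i
  refine ⟨a, convexHull_min hvu (convex_convexHull ℝ _) ha, ?_⟩
  rintro l (hl | hl)
  · exact convexHull_min hvF (convex_smallOn F ε) ha l hl
  · exact has l hl

theorem isFlat_iUnion_lt {F : ℕ → Set (List ℕ)} (hF : ∀ n, IsFlat (F n)) (N : ℕ) :
    IsFlat {l | ∃ n < N, l ∈ F n} := by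
  induction N with
  | zero => simpa using isFlat_empty
  | succ N ih =>
    convert ih.union (hF N) using 1
    ext l
    simp only [Set.mem_ofPred_eq, Set.mem_union, Nat.lt_succ_iff_lt_or_eq]
    constructor
    · rintro ⟨n, hn | rfl, hl⟩
      exacts [Or.inl ⟨n, hn, hl⟩, Or.inr hl]
    · rintro (⟨n, hn, hl⟩ | hl)
      exacts [⟨n, Or.inl hn, hl⟩, ⟨N, Or.inr rfl, hl⟩]

theorem list_sum_map_eq_zero {l : List ℕ} {a : ℕ → ℝ} (h : ∀ n ∈ l, a n = 0) :
    (l.map a).sum = 0 :=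
  List.sum_eq_zero (by simpa using h)

/-- The lists that continue the one-element list `[n]` in the family `F`. -/
def derivedFamily (F : Set (List ℕ)) (n : ℕ) : Set (List ℕ) := {l | n :: l ∈ F}

theorem isFlat_of_derivedFamily {F : Set (List ℕ)} (hF : ∀ l ∈ F, l.Pairwise (· < ·))
    (h : ∀ n, IsFlat (derivedFamily F n)) : IsFlat F := by
  intro u hu ε hε
  choose V hVu hVt hVs using fun M =>
    (isFlat_iUnion_lt h (M + 1)).exists_tail hu (half_pos hε) (M + 1)
  have hbd : ∀ M, ∃ N, M ≤ N ∧ ∀ n, N < n → V M n = 0 := fun M =>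
    ⟨max M ((V M).support.sup id), le_max_left _ _, fun n hn => by
      by_contra hne
      exact absurd (Finset.le_sup (f := id) (Finsupp.mem_support_iff.2 hne))
        (not_le.2 ((le_max_right _ _).trans_lt hn))⟩
  choose N hMN hN using hbd
  let M : ℕ → ℕ := fun i => N^[i] 0
  have hM : ∀ i, M (i + 1) = N (M i) := fun i => Function.iterate_succ_apply' _ _ _
  obtain ⟨r, hr⟩ := exists_nat_gt (2 / ε)
  have hr0 : (0 : ℝ) < r := lt_trans (by positivity) hr
  refine ⟨∑ i ∈ Finset.range r, (r : ℝ)⁻¹ • V (M i), ?_, ?_⟩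
  · refine (convex_convexHull ℝ _).sum_mem (fun _ _ => by positivity) ?_ fun i _ => hVu _
    simp [hr0.ne']
  · intro l hl
    have hsum : (l.map (∑ i ∈ Finset.range r, (r : ℝ)⁻¹ • V (M i) : ℕ →₀ ℝ)).sum =
        (r : ℝ)⁻¹ * ∑ i ∈ Finset.range r, (l.map (V (M i))).sum := by
      clear hl
      induction l with
      | nil => simp
      | cons n l ih =>
        simp only [List.map_cons, List.sum_cons, ih, Finset.sum_add_distrib, mul_add,
          Finsupp.finsetSum_apply, Finsupp.smul_apply, smul_eq_mul, Finset.mul_sum]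
    rw [hsum]
    cases l with
    | nil => simpa using hε.le
    | cons n l =>
      have hp := hF _ hl
      have hnl := List.pairwise_cons.1 hp
      have key : ∀ q : ℕ, ∑ i ∈ Finset.range q, ((n :: l).map (V (M i))).sum ≤
          (if n ≤ M q then (1 : ℝ) else 0) + q * (ε / 2) := by
        intro q
        induction q with
        | zero => simp only [Finset.range_zero, Finset.sum_empty]; split_ifs <;> simp
        | succ q ih =>
          rw [Finset.sum_range_succ]
          push_cast
          by_cases hq : n ≤ M q
          · have h1 : ((n :: l).map (V (M q))).sum ≤ ε / 2 := by
              rw [List.map_cons, List.sum_cons, (hVt (M q)).2.2 n (by omega), zero_add]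
              exact hVs (M q) l ⟨n, by omega, hl⟩
            have h2 : n ≤ M (q + 1) := by
              rw [hM]
              exact hq.trans (hMN _)
            rw [if_pos hq] at ih
            rw [if_pos h2]
            linarith
          · have h1 : ((n :: l).map (V (M q))).sum ≤ if n ≤ M (q + 1) then (1 : ℝ) else 0 := by
              split_ifs with hq'
              · exact (hVt (M q)).2.1 _ hp
              · refine (list_sum_map_eq_zero fun k hk => hN _ _ ?_).le
                rw [← hM]
                rcases List.mem_cons.1 hk with rfl | hk
                · omega
                · have := hnl.1 k hk
                  omega
            rw [if_neg hq] at ih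
            linarith
      have h1 : (if n ≤ M r then (1 : ℝ) else 0) ≤ 1 := by split_ifs <;> norm_num
      have h2 : 1 ≤ r * (ε / 2) := by
        rw [div_lt_iff₀ hε] at hr
        linarith
      rw [inv_mul_le_iff₀ hr0]
      linarith [key r]

theorem exists_branch_of_not_isFlat {F : Set (List ℕ)} (hF : ∀ l ∈ F, l.Pairwise (· < ·))
    (h : ¬ IsFlat F) :
    ∃ b : ℕ → ℕ, ∀ r, ∃ l, (List.range r).map b ++ l ∈ F := by
  let S := {F : Set (List ℕ) // (∀ l ∈ F, l.Pairwise (· < ·)) ∧ ¬ IsFlat F}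
  have hstep : ∀ G : S, ∃ n, ¬ IsFlat (derivedFamily G.1 n) := fun G => by
    by_contra! hc
    exact G.2.2 (isFlat_of_derivedFamily G.2.1 hc)
  choose ν hν using hstep
  let next : S → S := fun G => ⟨derivedFamily G.1 (ν G),
    fun l hl => (List.pairwise_cons.1 (G.2.1 _ hl)).2, hν G⟩
  let D : ℕ → S := fun i => next^[i] ⟨F, hF, h⟩
  have hD : ∀ i, D (i + 1) = next (D i) := fun i => Function.iterate_succ_apply' _ _ _
  have hmem : ∀ r l, l ∈ (D r).1 ↔ (List.range r).map (fun i => ν (D i)) ++ l ∈ F := by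
    intro r
    induction r with
    | zero => intro l; simp [D]
    | succ r ih =>
      intro l
      rw [hD, List.range_succ, List.map_append, List.append_assoc]
      exact ih (ν (D r) :: l)
  refine ⟨fun i => ν (D i), fun r => ?_⟩
  obtain ⟨l, hl⟩ : (D r).1.Nonempty := by
    rw [Set.nonempty_iff_ne_empty]
    intro he
    exact (D r).2.2 (he ▸ isFlat_empty)
  exact ⟨l, (hmem r l).1 hl⟩

end FlatFamilies

section SpreadFamily

variable {X : Type*} [NormedAddCommGroup X] [NormedSpace ℝ X]

/-- The vectors `x (s 0), …, x (s (r - 1))` dominate the unit vector basis of `ℓ₁ʳ` with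
constant `m`. -/
def DominatesL1 (x : ℕ → X) (m r : ℕ) (s : ℕ → ℕ) : Prop :=
  ∀ c : ℕ → ℝ, ∑ i ∈ Finset.range r, |c i| ≤ m * ‖∑ i ∈ Finset.range r, c i • x (s i)‖

theorem DominatesL1.mono {x : ℕ → X} {m r q : ℕ} {s : ℕ → ℕ} (h : DominatesL1 x m r s)
    (hq : q ≤ r) : DominatesL1 x m q s := by
  intro c
  have h1 := h (fun i => if i < q then c i else 0)
  have hsub : Finset.range q ⊆ Finset.range r := Finset.range_mono hq
  rw [← Finset.sum_subset hsub, ← Finset.sum_subset hsub] at h1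
  · convert h1 using 1
    · refine Finset.sum_congr rfl fun i hi => ?_
      rw [if_pos (Finset.mem_range.1 hi)]
    · congr 2
      refine Finset.sum_congr rfl fun i hi => ?_
      rw [if_pos (Finset.mem_range.1 hi)]
  · intro i _ hi
    simp [if_neg (mt Finset.mem_range.2 hi)]
  · intro i _ hi
    simp [if_neg (mt Finset.mem_range.2 hi)]

theorem DominatesL1.congr {x : ℕ → X} {m r : ℕ} {s t : ℕ → ℕ} (h : DominatesL1 x m r s)
    (hst : ∀ i < r, s i = t i) : DominatesL1 x m r t := by
  intro c
  have : ∑ i ∈ Finset.range r, c i • x (t i) = ∑ i ∈ Finset.range r, c i • x (s i) :=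
    Finset.sum_congr rfl fun i hi => by rw [hst i (Finset.mem_range.1 hi)]
  rw [this]
  exact h c

theorem WeaklyNull.comp_strictMono {x : ℕ → X} (hx : WeaklyNull x) {s : ℕ → ℕ}
    (hs : StrictMono s) : WeaklyNull (x ∘ s) :=
  fun f => (hx f).comp hs.tendsto_atTop

theorem WeaklyNull.zero_mem_closure_convexHull {x : ℕ → X} (hx : WeaklyNull x) :
    (0 : X) ∈ closure (convexHull ℝ (Set.range x)) := by
  by_contra h0
  obtain ⟨f, u, hf0, hf⟩ := geometric_hahn_banach_point_closed
    (convex_convexHull ℝ (Set.range x)).closure isClosed_closure h0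
  rw [map_zero] at hf0
  have h1 : ∀ n, u ≤ f (x n) := fun n =>
    (hf _ (subset_closure (subset_convexHull _ _ ⟨n, rfl⟩))).le
  exact absurd (ge_of_tendsto' (hx f) h1) (not_le.2 hf0)

theorem WeaklyNull.not_forall_dominatesL1 {x : ℕ → X} (hx : WeaklyNull x) {s : ℕ → ℕ}
    (hs : StrictMono s) (m : ℕ) : ¬ ∀ r, DominatesL1 x m r s := by
  intro h
  have h0 := (hx.comp_strictMono hs).zero_mem_closure_convexHull
  rw [Metric.mem_closure_iff] at h0
  obtain ⟨y, hy, hyd⟩ := h0 ((m + 1 : ℝ)⁻¹) (by positivity)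
  rw [dist_zero_left] at hyd
  let P : Set (ℕ →₀ ℝ) :=
    {b | (∀ i, 0 ≤ b i) ∧ Finsupp.linearCombination ℝ (fun _ => (1 : ℝ)) b = 1}
  have hP : Convex ℝ P := by
    intro a ha b hb p q hp hq hpq
    refine ⟨fun i => ?_, ?_⟩
    · have := mul_nonneg hp (ha.1 i)
      have := mul_nonneg hq (hb.1 i)
      simp only [Finsupp.add_apply, Finsupp.smul_apply, smul_eq_mul]
      linarith
    · rw [map_add, map_smul, map_smul, ha.2, hb.2]
      simpa using hpq
  have hsub : convexHull ℝ (Set.range (x ∘ s)) ⊆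
      Finsupp.linearCombination ℝ (x ∘ s) '' P := by
    refine convexHull_min ?_ (hP.linear_image _)
    rintro _ ⟨i, rfl⟩
    refine ⟨Finsupp.single i 1, ⟨fun j => ?_, by simp⟩, by simp⟩
    rw [Finsupp.single_apply]
    split_ifs <;> norm_num
  obtain ⟨b, ⟨hb0, hb1⟩, rfl⟩ := hsub hy
  obtain ⟨r, hr⟩ : ∃ r, b.support ⊆ Finset.range r := b.support.exists_nat_subset_range
  have h1 := h r b
  rw [Finsupp.linearCombination_apply, Finsupp.sum_of_support_subset _ hr _ (by simp)] at hb1 hyd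
  simp only [smul_eq_mul, mul_one] at hb1
  rw [Finset.sum_congr rfl fun i _ => abs_of_nonneg (hb0 i), hb1] at h1
  simp only [Function.comp_apply] at hyd
  have h2 := mul_lt_mul_of_pos_left hyd (by positivity : (0 : ℝ) < m + 1)
  rw [mul_inv_cancel₀ (by positivity)] at h2
  nlinarith [norm_nonneg (∑ i ∈ Finset.range r, b i • x (s i))]

/-- The increasing lists `b₀ < b₁ < ⋯ < bᵣ` for which some increasing `s₀ < ⋯ < sᵣ₋₁` with
`sᵢ ≤ bᵢ₊₁` indexes a copy of the `ℓ₁ʳ` basis in `x` with constant `b₀`. -/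
def spreadFamily (x : ℕ → X) : Set (List ℕ) :=
  {l | l.Pairwise (· < ·) ∧ ∃ s : ℕ → ℕ, StrictMono s ∧
    (∀ i, i + 1 < l.length → s i ≤ l.getD (i + 1) 0) ∧
    DominatesL1 x (l.getD 0 0) (l.length - 1) s}

theorem singleton_mem_spreadFamily (x : ℕ → X) (n : ℕ) : [n] ∈ spreadFamily x :=
  ⟨by simp, id, strictMono_id, by simp, fun c => by simp⟩

theorem exists_strictMono_limit {b : ℕ → ℕ} {t : ℕ → ℕ → ℕ} (ht : ∀ r, StrictMono (t r))
    (hb : ∀ r, ∀ i < r, t r i ≤ b i) :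
    ∃ s : ℕ → ℕ, StrictMono s ∧ ∀ r, ∃ q ≥ r, ∀ i < r, t q i = s i := by
  have hlim : ∀ i, ∃ v, ∀ᶠ r in (hyperfilter ℕ : Filter ℕ), t r i = v := by
    intro i
    have h1 : ∀ᶠ r in (hyperfilter ℕ : Filter ℕ), i < r :=
      Nat.hyperfilter_le_atTop (eventually_gt_atTop i)
    have h2 : (⋃ v ∈ Set.Iic (b i), {r | t r i = v}) ∈ hyperfilter ℕ := by
      filter_upwards [h1] with r hr
      simpa using hb r i hr
    obtain ⟨v, -, hv⟩ := (Ultrafilter.finite_biUnion_mem_iff (Set.finite_Iic _)).1 h2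
    exact ⟨v, hv⟩
  choose s hs using hlim
  refine ⟨s, strictMono_nat_of_lt_succ fun i => ?_, fun r => ?_⟩
  · obtain ⟨r, h1, h2⟩ := ((hs i).and (hs (i + 1))).exists
    rw [← h1, ← h2]
    exact ht r (Nat.lt_succ_self i)
  · have h1 : ∀ᶠ q in (hyperfilter ℕ : Filter ℕ), ∀ i ∈ Set.Iio r, t q i = s i :=
      (eventually_all_finite (Set.finite_Iio r)).2 fun i _ => hs i
    obtain ⟨q, h2, h3⟩ := (h1.and (Nat.hyperfilter_le_atTop (eventually_ge_atTop r))).exists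
    exact ⟨q, h3, h2⟩

theorem WeaklyNull.isFlat_spreadFamily {x : ℕ → X} (hx : WeaklyNull x) :
    IsFlat (spreadFamily x) := by
  by_contra hnf
  obtain ⟨b, hb⟩ := exists_branch_of_not_isFlat (fun l hl => hl.1) hnf
  choose l hl using fun r => hb (r + 1)
  choose t ht htb htd using fun r => (hl r).2
  have hget : ∀ r i, i < r + 1 → ((List.range (r + 1)).map b ++ l r).getD i 0 = b i := by
    intro r i hi
    rw [List.getD_append _ _ _ _ (by simpa using hi), List.getD_eq_getElem _ _ (by simpa using hi)]
    simp
  have hb' : ∀ r, ∀ i < r, t r i ≤ b (i + 1) := by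
    intro r i hi
    rw [← hget r (i + 1) (by omega)]
    refine htb r i ?_
    simp only [List.length_append, List.length_map, List.length_range]
    omega
  obtain ⟨s, hs, hst⟩ := exists_strictMono_limit ht hb'
  refine hx.not_forall_dominatesL1 hs (b 0) fun r => ?_
  obtain ⟨q, hq, hqs⟩ := hst r
  have h1 := htd q
  rw [hget q 0 (by omega)] at h1
  refine (h1.mono ?_).congr hqs
  simp only [List.length_append, List.length_map, List.length_range]
  omega

end SpreadFamily

section SchreierSpace

open scoped ENNReal ZeroAtInfty

/-- The space `c₀` of real null sequences. -/
def NullSeq : Type := C₀(ℕ, ℝ)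

namespace NullSeq

noncomputable instance : NormedAddCommGroup NullSeq :=
  inferInstanceAs (NormedAddCommGroup C₀(ℕ, ℝ))

noncomputable instance : NormedSpace ℝ NullSeq := inferInstanceAs (NormedSpace ℝ C₀(ℕ, ℝ))

instance : CompleteSpace NullSeq := inferInstanceAs (CompleteSpace C₀(ℕ, ℝ))

instance : FunLike NullSeq ℕ ℝ := inferInstanceAs (FunLike C₀(ℕ, ℝ) ℕ ℝ)

theorem add_apply (v w : NullSeq) (n : ℕ) : (v + w) n = v n + w n := rfl

theorem smul_apply (c : ℝ) (w : NullSeq) (n : ℕ) : (c • w) n = c * w n := rfl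

theorem zero_apply (n : ℕ) : (0 : NullSeq) n = 0 := rfl

theorem tendsto_zero (w : NullSeq) : Tendsto w atTop (nhds 0) := by
  have h := ZeroAtInftyContinuousMap.zero_at_infty' (α := ℕ) (β := ℝ) w
  rwa [cocompact_eq_cofinite, Nat.cofinite_eq_atTop] at h

theorem abs_apply_le_norm (w : NullSeq) (n : ℕ) : |w n| ≤ ‖w‖ :=
  (ZeroAtInftyContinuousMap.toBCF (α := ℕ) (β := ℝ) w).norm_coe_le_norm n

theorem norm_le {w : NullSeq} {C : ℝ} (hC : 0 ≤ C) (h : ∀ n, |w n| ≤ C) : ‖w‖ ≤ C :=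
  (BoundedContinuousFunction.norm_le (f := ZeroAtInftyContinuousMap.toBCF (α := ℕ) (β := ℝ) w)
    hC).2 h

/-- Evaluation of a null sequence at a coordinate. -/
noncomputable def coord (n : ℕ) : NullSeq →L[ℝ] ℝ :=
  LinearMap.mkContinuous
    { toFun := fun w => w n, map_add' := fun _ _ => rfl, map_smul' := fun _ _ => rfl } 1
    fun w => (abs_apply_le_norm w n).trans_eq (one_mul _).symm

/-- A finitely supported sequence as a null sequence. -/
noncomputable def ofFinsupp : (ℕ →₀ ℝ) →ₗ[ℝ] NullSeq where
  toFun a := (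
    { toFun := a
      continuous_toFun := continuous_of_discreteTopology
      zero_at_infty' := by
        rw [cocompact_eq_cofinite]
        refine tendsto_const_nhds.congr' ?_
        filter_upwards [a.support.finite_toSet.compl_mem_cofinite] with n hn
        simpa [eq_comm] using hn } : C₀(ℕ, ℝ))
  map_add' _ _ := rfl
  map_smul' _ _ := rfl

end NullSeq

/-- The pairs `(w, v)` with `w ∈ c₀` and `v` the bounded family of all signed sums of `w`
along the members of `F`; its norm is a Schreier-type norm of `w`. -/
def schreierSpace (F : Set (List ℕ)) :
    Submodule ℝ (NullSeq × lp (fun _ : F × (ℕ → SignType) => ℝ) ∞) where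
  carrier := {p | ∀ i, p.2 i = (i.1.1.map fun n => (i.2 n : ℝ) * p.1 n).sum}
  add_mem' := by
    intro p q hp hq i
    have h := list_sum_map_combo i.1.1 1 1 (fun n => (i.2 n : ℝ) * p.1 n)
      (fun n => (i.2 n : ℝ) * q.1 n)
    simp only [one_mul] at h
    simp only [Prod.snd_add, Prod.fst_add, lp.coeFn_add, Pi.add_apply,
      NullSeq.add_apply, mul_add, h, hp i, hq i]
  zero_mem' := by
    intro i
    simp [NullSeq.zero_apply]
  smul_mem' := by
    intro c p hp i
    have h := list_sum_map_combo i.1.1 c 0 (fun n => (i.2 n : ℝ) * p.1 n) 0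
    simp only [zero_mul, add_zero] at h
    simp only [Prod.smul_snd, Prod.smul_fst, lp.coeFn_smul, Pi.smul_apply,
      NullSeq.smul_apply, smul_eq_mul, hp i, ← h, mul_left_comm]

theorem isClosed_schreierSpace (F : Set (List ℕ)) :
    IsClosed (schreierSpace F : Set (NullSeq × lp (fun _ : F × (ℕ → SignType) => ℝ) ∞)) := by
  have : (schreierSpace F : Set (NullSeq × lp (fun _ : F × (ℕ → SignType) => ℝ) ∞)) =
      ⋂ i, {p | p.2 i = (i.1.1.map fun n => (i.2 n : ℝ) * p.1 n).sum} := by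
    ext p
    simp only [Set.mem_iInter]
    rfl
  rw [this]
  refine isClosed_iInter fun i => isClosed_eq ?_ ?_
  · exact (lp.evalCLM ℝ (fun _ : F × (ℕ → SignType) => ℝ) ∞ i).continuous.comp continuous_snd
  · refine continuous_list_sum _ fun n _ => continuous_const.mul ?_
    exact (NullSeq.coord n).continuous.comp continuous_fst

instance (F : Set (List ℕ)) : CompleteSpace (schreierSpace F) :=
  (isClosed_schreierSpace F).completeSpace_coe

theorem list_sum_abs_le_norm {F : Set (List ℕ)} (z : schreierSpace F) {l : List ℕ}
    (hl : l ∈ F) : (l.map fun n => |z.1.1 n|).sum ≤ ‖z‖ := by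
  have h := z.2 (⟨l, hl⟩, fun n => SignType.sign (z.1.1 n))
  simp only [sign_mul_self] at h
  rw [← h]
  exact (le_abs_self _).trans ((lp.norm_apply_le_norm ENNReal.top_ne_zero z.1.2 _).trans
    (norm_snd_le z.1))

theorem abs_list_sum_sign_mul_le (l : List ℕ) (σ : ℕ → SignType) (a : ℕ → ℝ) :
    |(l.map fun n => (σ n : ℝ) * a n).sum| ≤ (l.map fun n => |a n|).sum := by
  induction l with
  | nil => simp
  | cons n l ih =>
    simp only [List.map_cons, List.sum_cons]
    refine (abs_add_le _ _).trans (add_le_add ?_ ih)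
    rcases hσ : σ n with _ | _ | _ <;> simp

theorem list_sum_abs_le_support {l : List ℕ} (hl : l.Pairwise (· < ·)) (a : ℕ →₀ ℝ) :
    (l.map fun n => |a n|).sum ≤ ∑ n ∈ a.support, |a n| := by
  rw [← List.sum_toFinset _ (hl.imp fun h => h.ne)]
  rw [← Finset.sum_filter_ne_zero]
  refine Finset.sum_le_sum_of_subset_of_nonneg (fun n hn => ?_) fun _ _ _ => abs_nonneg _
  simpa using (Finset.mem_filter.1 hn).2

theorem single_mem_subprobTail {i n : ℕ} (h : i ≤ n) : Finsupp.single n 1 ∈ subprobTail i := by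
  have h0 : ∀ k, 0 ≤ (Finsupp.single n (1 : ℝ)) k := fun k => by
    rw [Finsupp.single_apply]
    split_ifs <;> norm_num
  refine ⟨h0, fun l hl => ?_, fun k hk => Finsupp.single_eq_of_ne (by omega)⟩
  have h1 := list_sum_abs_le_support hl (Finsupp.single n 1)
  simp only [abs_of_nonneg (h0 _)] at h1
  exact h1.trans ((Finset.sum_le_sum_of_subset_of_nonneg Finsupp.support_single_subset
    fun k _ _ => h0 k).trans (by simp))

/-- A finitely supported sequence as an element of the Schreier-type space of `F`. -/
noncomputable def finsuppToSchreier {F : Set (List ℕ)} (hF : ∀ l ∈ F, l.Pairwise (· < ·)) :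
    (ℕ →₀ ℝ) →ₗ[ℝ] schreierSpace F where
  toFun a := ⟨(NullSeq.ofFinsupp a, ⟨fun i => (i.1.1.map fun n => (i.2 n : ℝ) * a n).sum,
    memℓp_infty ⟨∑ n ∈ a.support, |a n|, by
      rintro _ ⟨i, rfl⟩
      exact (abs_list_sum_sign_mul_le _ _ _).trans
        (list_sum_abs_le_support (hF _ i.1.2) a)⟩⟩), fun _ => rfl⟩
  map_add' a b := by
    refine Subtype.ext (Prod.ext (map_add _ _ _) (lp.ext (funext fun i => ?_)))
    have h := list_sum_map_combo i.1.1 1 1 (fun n => (i.2 n : ℝ) * a n)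
      (fun n => (i.2 n : ℝ) * b n)
    simp only [one_mul, ← mul_add] at h
    exact h
  map_smul' c a := by
    refine Subtype.ext (Prod.ext (map_smul _ _ _) (lp.ext (funext fun i => ?_)))
    have h := list_sum_map_combo i.1.1 c 0 (fun n => (i.2 n : ℝ) * a n) 0
    simp only [zero_mul, add_zero, mul_left_comm c] at h
    exact h

theorem norm_finsuppToSchreier_le {F : Set (List ℕ)} (hF : ∀ l ∈ F, l.Pairwise (· < ·))
    (hsing : ∀ n, [n] ∈ F) {a : ℕ →₀ ℝ} (ha : ∀ n, 0 ≤ a n) {ε : ℝ} (hε : 0 ≤ ε)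
    (has : a ∈ smallOn F ε) : ‖finsuppToSchreier hF a‖ ≤ ε := by
  refine norm_prod_le_iff.2 ⟨?_, lp.norm_le_of_forall_le hε fun i => ?_⟩
  · refine NullSeq.norm_le hε fun n => ?_
    have h := has _ (hsing n)
    simp only [List.map_cons, List.map_nil, List.sum_cons, List.sum_nil, add_zero] at h
    exact (abs_of_nonneg (ha n)).trans_le h
  · refine (abs_list_sum_sign_mul_le i.1.1 i.2 a).trans ?_
    simpa only [abs_of_nonneg (ha _)] using has _ i.1.2

theorem weaklyNull_finsuppToSchreier_single {F : Set (List ℕ)}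
    (hF : ∀ l ∈ F, l.Pairwise (· < ·)) (hsing : ∀ n, [n] ∈ F) (hflat : IsFlat F) :
    WeaklyNull fun n => finsuppToSchreier hF (Finsupp.single n 1) := by
  have key : ∀ f : schreierSpace F →L[ℝ] ℝ, ∀ δ > 0,
      ∀ᶠ n in atTop, f (finsuppToSchreier hF (Finsupp.single n 1)) < δ := by
    intro f δ hδ
    by_contra hc
    obtain ⟨φ, hφ, hφδ⟩ := extraction_of_frequently_atTop (not_eventually.1 hc)
    simp only [not_lt] at hφδ
    have hu : ∀ i, Finsupp.single (φ i) (1 : ℝ) ∈ subprobTail i := fun i =>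
      single_mem_subprobTail (hφ.id_le i)
    have hε : 0 < δ / (‖f‖ + 1) := by positivity
    obtain ⟨a, ha, hat, has⟩ := hflat.exists_tail hu hε 0
    have h1 : δ ≤ f (finsuppToSchreier hF a) := by
      have hconv : Convex ℝ {b | δ ≤ (f.toLinearMap ∘ₗ finsuppToSchreier hF) b} :=
        convex_halfSpace_ge (LinearMap.isLinear _) δ
      refine convexHull_min ?_ hconv ha
      rintro _ ⟨i, rfl⟩
      exact hφδ i
    have h2 := norm_finsuppToSchreier_le hF hsing hat.1 hε.le has
    have h3 := (le_abs_self _).trans (f.le_opNorm (finsuppToSchreier hF a))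
    have h4 : ‖f‖ * (δ / (‖f‖ + 1)) < δ := by
      rw [← mul_div_assoc, div_lt_iff₀ (by positivity)]
      nlinarith
    have h5 := mul_le_mul_of_nonneg_left h2 (norm_nonneg f)
    linarith
  intro f
  rw [Metric.tendsto_atTop']
  intro δ hδ
  obtain ⟨N, hN⟩ := eventually_atTop.1 ((key f δ hδ).and (key (-f) δ hδ))
  refine ⟨N, fun n hn => ?_⟩
  rw [Real.dist_eq, sub_zero, abs_lt]
  have := hN n hn.le
  simp only [neg_apply] at this
  exact ⟨by linarith [this.2], this.1⟩

/-- The forgetful operator from the Schreier-type space to `c₀`. -/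
noncomputable def schreierToNullSeq (F : Set (List ℕ)) : schreierSpace F →L[ℝ] NullSeq :=
  (ContinuousLinearMap.fst ℝ _ _).comp (schreierSpace F).subtypeL

theorem not_completelyContinuous_schreierToNullSeq {F : Set (List ℕ)}
    (hF : ∀ l ∈ F, l.Pairwise (· < ·)) (hsing : ∀ n, [n] ∈ F) (hflat : IsFlat F) :
    ¬ CompletelyContinuous (schreierToNullSeq F) := by
  intro h
  have hs : ∀ n, Finsupp.single n (1 : ℝ) ∈ subprobTail 0 := fun n =>
    single_mem_subprobTail (Nat.zero_le n)
  have h1 := h _ (fun n => norm_finsuppToSchreier_le hF hsing (hs n).1 zero_le_one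
    fun l hl => (hs n).2.1 l (hF l hl)) (weaklyNull_finsuppToSchreier_single hF hsing hflat)
  refine absurd (ge_of_tendsto' h1 fun n => ?_) (not_le.2 one_pos)
  have h2 := NullSeq.abs_apply_le_norm
    (schreierToNullSeq F (finsuppToSchreier hF (Finsupp.single n 1))) n
  have h3 : schreierToNullSeq F (finsuppToSchreier hF (Finsupp.single n 1)) n = 1 :=
    Finsupp.single_eq_same
  rwa [h3, abs_one] at h2

end SchreierSpace

section SlidingHump

theorem exists_sliding_hump {w : ℕ → ℕ → ℝ} (hrow : ∀ n, Tendsto (w n) atTop (nhds 0))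
    (hcol : ∀ k, Tendsto (fun n => w n k) atTop (nhds 0)) {η : ℝ}
    (hbig : ∀ n, ∃ k, η ≤ |w n k|) {ε : ℕ → ℝ} (hε : ∀ j, 0 < ε j) (hεη : ∀ j, ε j < η)
    (hanti : Antitone ε) (m : ℕ) :
    ∃ n k : ℕ → ℕ, StrictMono n ∧ StrictMono k ∧ m ≤ k 0 ∧ (∀ j, n j ≤ k (j + 1)) ∧
      (∀ j, η ≤ |w (n j) (k j)|) ∧ ∀ i j, i ≠ j → |w (n i) (k j)| ≤ ε j := by
  have hsmall : ∀ {u : ℕ → ℝ}, Tendsto u atTop (nhds 0) → ∀ j, ∀ᶠ n in atTop, |u n| ≤ ε j := by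
    intro u hu j
    filter_upwards [(tendsto_zero_iff_abs_tendsto_zero u).1 hu |>.eventually (gt_mem_nhds (hε j))]
      with n hn using hn.le
  have hstep : ∀ j N, ∃ p q, N < p ∧ N < q ∧ (∀ k ≤ N, |w p k| ≤ ε j) ∧
      (∀ n ≤ N, |w n q| ≤ ε j) ∧ η ≤ |w p q| := by
    intro j N
    obtain ⟨K, hK⟩ := eventually_atTop.1 ((eventually_all_finite (Set.finite_Iic N)).2
      fun n _ => hsmall (hrow n) j)
    obtain ⟨p, hp, hNp⟩ := (((eventually_all_finite (Set.finite_Iic (max K N))).2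
      fun k _ => hsmall (hcol k) j).and (eventually_gt_atTop N)).exists
    obtain ⟨q, hq⟩ := hbig p
    have hqK : max K N < q := by
      by_contra! hc
      exact absurd (hq.trans (hp q hc)) (not_le.2 (hεη j))
    exact ⟨p, q, hNp, (le_max_right _ _).trans_lt hqK,
      fun k hk => hp k (hk.trans (le_max_right _ _)),
      fun n hn => hK q ((le_max_left _ _).trans hqK.le) n hn, hq⟩
  choose p q hp hq hpk hnq hpq using hstep
  let N : ℕ → ℕ := fun j => Nat.rec (motive := fun _ => ℕ) m (fun j N => max (p j N) (q j N)) j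
  have hN : ∀ j, N (j + 1) = max (p j (N j)) (q j (N j)) := fun j => rfl
  have hpN : ∀ j, p j (N j) ≤ N (j + 1) := fun j => hN j ▸ le_max_left _ _
  have hqN : ∀ j, q j (N j) ≤ N (j + 1) := fun j => hN j ▸ le_max_right _ _
  have hmono : Monotone N := monotone_nat_of_le_succ fun j => (hp j (N j)).le.trans (hpN j)
  refine ⟨fun j => p j (N j), fun j => q j (N j),
    strictMono_nat_of_lt_succ fun j => (hpN j).trans_lt (hp _ _),
    strictMono_nat_of_lt_succ fun j => (hqN j).trans_lt (hq _ _), (hq 0 m).le,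
    fun j => (hpN j).trans (hq _ _).le, fun j => hpq _ _, fun i j hij => ?_⟩
  rcases hij.lt_or_gt with h | h
  · exact hnq j (N j) _ ((hpN i).trans (hmono h))
  · exact (hpk i (N i) _ ((hqN j).trans (hmono h))).trans (hanti h.le)

theorem sum_abs_le_of_diagonal {W : ℕ → ℕ → ℝ} {η : ℝ}
    (hη : 0 ≤ η)
    (hdiag : ∀ j, η ≤ |W j j|) (hoff : ∀ i j, i ≠ j → |W i j| ≤ η / 2 * (1 / 2) ^ (j + 1))
    (c : ℕ → ℝ) (r : ℕ) :
    η / 2 * ∑ i ∈ Finset.range r, |c i| ≤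
      ∑ j ∈ Finset.range r, |∑ i ∈ Finset.range r, c i * W i j| := by
  set A := ∑ i ∈ Finset.range r, |c i| with hA
  have hA0 : 0 ≤ A := Finset.sum_nonneg fun _ _ => abs_nonneg _
  have hj : ∀ j ∈ Finset.range r, η * |c j| - A * (η / 2 * (1 / 2) ^ (j + 1)) ≤
      |∑ i ∈ Finset.range r, c i * W i j| := by
    intro j hj
    rw [← Finset.add_sum_erase _ _ hj]
    have h1 : |∑ i ∈ (Finset.range r).erase j, c i * W i j| ≤
        A * (η / 2 * (1 / 2) ^ (j + 1)) := by
      refine (Finset.abs_sum_le_sum_abs _ _).trans ?_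
      calc ∑ i ∈ (Finset.range r).erase j, |c i * W i j|
          ≤ ∑ i ∈ (Finset.range r).erase j, |c i| * (η / 2 * (1 / 2) ^ (j + 1)) := by
            refine Finset.sum_le_sum fun i hi => ?_
            rw [abs_mul]
            exact mul_le_mul_of_nonneg_left (hoff i j (Finset.ne_of_mem_erase hi)) (abs_nonneg _)
        _ ≤ A * (η / 2 * (1 / 2) ^ (j + 1)) := by
            rw [← Finset.sum_mul]
            refine mul_le_mul_of_nonneg_right ?_ (by positivity)
            exact Finset.sum_le_sum_of_subset_of_nonneg (Finset.erase_subset _ _)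
              fun _ _ _ => abs_nonneg _
    have h2 : η * |c j| ≤ |c j * W j j| := by
      rw [abs_mul, mul_comm]
      exact mul_le_mul_of_nonneg_left (hdiag j) (abs_nonneg _)
    have h3 := abs_sub_abs_le_abs_add (c j * W j j) (∑ i ∈ (Finset.range r).erase j, c i * W i j)
    linarith
  have hgeom : ∑ j ∈ Finset.range r, ((1 : ℝ) / 2) ^ (j + 1) ≤ 1 := by
    have h : ∑ j ∈ Finset.range r, ((1 : ℝ) / 2) ^ (j + 1) = 1 - (1 / 2) ^ r := by
      clear hj hA0 hA A
      induction r with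
      | zero => simp
      | succ r ih => rw [Finset.sum_range_succ, ih, pow_succ]; ring
    rw [h]
    have : (0 : ℝ) ≤ (1 / 2) ^ r := by positivity
    linarith
  refine le_trans ?_ (Finset.sum_le_sum hj)
  rw [Finset.sum_sub_distrib, ← Finset.mul_sum, ← Finset.mul_sum, ← Finset.mul_sum, ← hA]
  have := mul_le_mul_of_nonneg_left hgeom (by positivity : 0 ≤ A * (η / 2))
  linarith

end SlidingHump

theorem exists_subsequence_of_not_completelyContinuous {X Y : Type*} [NormedAddCommGroup X]
    [NormedSpace ℝ X] [NormedAddCommGroup Y] [NormedSpace ℝ Y] {A : X →L[ℝ] Y}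
    (hA : ¬ CompletelyContinuous A) :
    ∃ x : ℕ → X, WeaklyNull x ∧ ∃ δ > 0, ∀ n, δ ≤ ‖A (x n)‖ := by
  unfold CompletelyContinuous at hA
  push Not at hA
  obtain ⟨x, -, hx, hnt⟩ := hA
  rw [Metric.tendsto_atTop] at hnt
  push Not at hnt
  obtain ⟨δ, hδ, hfreq⟩ := hnt
  obtain ⟨φ, hφ, hφδ⟩ := extraction_of_frequently_atTop (frequently_atTop.2 hfreq)
  refine ⟨x ∘ φ, hx.comp_strictMono hφ, δ, hδ, fun n => ?_⟩
  simpa using hφδ n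

/-- The vectors whose coordinates form a sliding hump in the Schreier-type space dominate the
`ℓ₁` basis as soon as the hump positions form a member of the family. -/
theorem dominatesL1_of_mem_family {X : Type*} [NormedAddCommGroup X] [NormedSpace ℝ X]
    {F : Set (List ℕ)} (C : X →L[ℝ] schreierSpace F) {x : ℕ → X} {n k : ℕ → ℕ} {η : ℝ}
    (hη : 0 < η) (hdiag : ∀ j, η ≤ |(C (x (n j))).1.1 (k j)|)
    (hoff : ∀ i j, i ≠ j → |(C (x (n i))).1.1 (k j)| ≤ η / 2 * (1 / 2) ^ (j + 1))
    {m r : ℕ} (hm : 2 * ‖C‖ / η ≤ m) (hmem : (List.range r).map k ∈ F) :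
    DominatesL1 x m r n := by
  intro c
  set y := ∑ i ∈ Finset.range r, c i • x (n i) with hy
  have hcoord : ∀ j, (C y).1.1 j = ∑ i ∈ Finset.range r, c i * (C (x (n i))).1.1 j := by
    intro j
    have : (C y).1.1 j = ((NullSeq.coord j).comp ((schreierToNullSeq F).comp C)) y := rfl
    rw [this, hy, map_sum]
    refine Finset.sum_congr rfl fun i _ => ?_
    rw [map_smul]
    rfl
  have h1 := sum_abs_le_of_diagonal hη.le hdiag hoff c r
  have h2 := list_sum_abs_le_norm (C y) hmem
  have h3 : ((List.range r).map k |>.map fun n => |(C y).1.1 n|).sum =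
      ∑ j ∈ Finset.range r, |(C y).1.1 (k j)| := by
    rw [List.map_map]
    rfl
  rw [h3] at h2
  simp only [hcoord] at h2
  have h4 := C.le_opNorm y
  have h5 : 2 * ‖C‖ ≤ m * η := by rwa [div_le_iff₀ hη] at hm
  have h6 := mul_le_mul_of_nonneg_right h5 (norm_nonneg y)
  refine le_of_mul_le_mul_left ?_ hη
  linarith

theorem statement7 :
    ¬ ∃ (E F : BanachSp) (U : E.carrier →L[ℝ] F.carrier),
      ¬ CompletelyContinuous U ∧
        ∀ (Z W : BanachSp) (T : Z.carrier →L[ℝ] W.carrier),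
          ¬ CompletelyContinuous T → FactorsThrough U T := by
  rintro ⟨E, F, U, hU, huniv⟩
  obtain ⟨x, hx, δ, hδ, hxδ⟩ := exists_subsequence_of_not_completelyContinuous hU
  have hF : ∀ l ∈ spreadFamily x, l.Pairwise (· < ·) := fun l hl => hl.1
  obtain ⟨C, D, hCD⟩ := huniv ⟨schreierSpace (spreadFamily x)⟩ ⟨NullSeq⟩
    (schreierToNullSeq (spreadFamily x)) (not_completelyContinuous_schreierToNullSeq hF
      (singleton_mem_spreadFamily x) hx.isFlat_spreadFamily)
  change E.carrier →L[ℝ] schreierSpace (spreadFamily x) at C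
  change NullSeq →L[ℝ] F.carrier at D
  set η := δ / (‖D‖ + 1) with hηdef
  have hη : 0 < η := by positivity
  have hbig : ∀ n, ∃ k, η / 2 ≤ |(C (x n)).1.1 k| := by
    intro n
    by_contra! hc
    have h1 : ‖(C (x n)).1.1‖ ≤ η / 2 :=
      NullSeq.norm_le (half_pos hη).le fun k => (hc k).le
    have h2 := (hxδ n).trans_eq (congrArg norm (hCD (x n))).symm
    have h3 := h2.trans (D.le_opNorm (C (x n)).1.1)
    have h4 : δ = (‖D‖ + 1) * η := by rw [hηdef]; field_simp
    have h5 := mul_le_mul_of_nonneg_left h1 (norm_nonneg D)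
    nlinarith [norm_nonneg D]
  obtain ⟨m, hm⟩ := exists_nat_ge (2 * ‖C‖ / (η / 2))
  obtain ⟨n, k, hn, hk, hmk, hnk, hdiag, hoff⟩ := exists_sliding_hump
    (w := fun n k => (C (x n)).1.1 k) (ε := fun j => η / 2 / 2 * (1 / 2) ^ (j + 1))
    (fun n => (C (x n)).1.1.tendsto_zero)
    (fun k => hx ((NullSeq.coord k).comp ((schreierToNullSeq (spreadFamily x)).comp C))) hbig
    (fun j => by positivity)
    (fun j => by
      have : ((1 : ℝ) / 2) ^ (j + 1) ≤ 1 := pow_le_one₀ (by norm_num) (by norm_num)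
      nlinarith)
    (fun i j hij => mul_le_mul_of_nonneg_left
      (pow_le_pow_of_le_one (by norm_num) (by norm_num) (by omega)) (by positivity)) m
  refine hx.not_forall_dominatesL1 hn (k 0) fun r => ?_
  induction r with
  | zero => exact fun c => by simp
  | succ r ih =>
    refine dominatesL1_of_mem_family C (half_pos hη) hdiag hoff
      (hm.trans (by exact_mod_cast hmk)) ⟨?_, n, hn, fun i hi => ?_, ?_⟩
    · exact List.pairwise_map.2 (List.pairwise_lt_range.imp fun h => hk h)
    · rw [List.getD_eq_getElem _ _ hi]
      simpa using hnk i
    · rw [List.getD_eq_getElem _ _ (by simp)]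
      simpa using ih
end

section
/- There is no universal operator for the complement of the class of Dunford–Pettis operators: there does not exist a bounded operator U between real Banach spaces such that U is not Dunford–Pettis and U factors through every operator between Banach spaces that is not Dunford–Pettis. -/
/-!
STATEMENT 8: There is no universal operator for the complement of the class of
Dunford–Pettis operators: there is no bounded operator `U` between real Banach spaces such
that `U` is not Dunford–Pettis and `U` factors through every operator between Banach
spaces that is not Dunford–Pettis.
-/

open Filter

/-- An operator `A : X → Y` is Dunford–Pettis if `gₙ (A xₙ) → 0` for every weakly null
sequence `(xₙ)` in `X` and every weakly null sequence `(gₙ)` in `Y*`. -/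
def DunfordPettis {X Y : Type*} [NormedAddCommGroup X] [NormedSpace ℝ X]
    [NormedAddCommGroup Y] [NormedSpace ℝ Y] (A : X →L[ℝ] Y) : Prop :=
  ∀ (x : ℕ → X) (g : ℕ → (Y →L[ℝ] ℝ)), WeaklyNull x → WeaklyNull g →
    Tendsto (fun n => g n (A (x n))) atTop (nhds 0)



/-- `B` is admissible below `α` if its elements `b` carry labels `f b ≤ b` whose ranks `ρ (f b)`
lie below `α` and strictly decrease along `B`. -/
def RankAdmissible (ρ : ℕ → Ordinal.{0}) (α : Ordinal.{0}) (B : Finset ℕ) : Prop :=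
  ∃ f : ℕ → ℕ, (∀ b ∈ B, f b ≤ b ∧ ρ (f b) < α) ∧
    ∀ b ∈ B, ∀ b' ∈ B, b < b' → ρ (f b') < ρ (f b)

/-- Pták's combinatorial lemma for the families `RankAdmissible ρ α`. -/
theorem RankAdmissible.exists_convex_combination (ρ : ℕ → Ordinal.{0}) (α : Ordinal.{0}) :
    ∀ N : Set ℕ, N.Infinite → ∀ ε : ℝ, 0 < ε → ∃ (s : Finset ℕ) (a : ℕ → ℝ),
      (∀ i ∈ s, i ∈ N) ∧ (∀ i, 0 ≤ a i) ∧ (∀ i ∉ s, a i = 0) ∧ ∑ i ∈ s, a i = 1 ∧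
      ∀ B, RankAdmissible ρ α B → ∑ i ∈ B, a i ≤ ε := by
  induction α using WellFoundedLT.induction with
  | ind α ih =>
  intro N hN ε hε
  rcases eq_zero_or_pos α with rfl | hα
  · obtain ⟨n, hn⟩ := hN.nonempty
    refine ⟨{n}, Pi.single n 1, by simpa using hn, fun i ↦ ?_, fun i hi ↦ ?_, by simp, ?_⟩
    · rw [Pi.single_apply]
      split_ifs <;> simp
    · exact Pi.single_eq_of_ne (by simpa using hi) _
    · rintro B ⟨f, hf, -⟩
      have : B = ∅ := Finset.eq_empty_of_forall_notMem fun b hb ↦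
        absurd (hf b hb).2 not_lt_zero
      simp [this, hε.le]
  have key : ∀ k : ℕ, ∃ (s : Finset ℕ) (a : ℕ → ℝ),
      (∀ i ∈ s, i ∈ N) ∧ (∀ i, 0 ≤ a i) ∧ (∀ i ∉ s, a i = 0) ∧ ∑ i ∈ s, a i = k ∧
      ∀ B, RankAdmissible ρ α B → ∑ i ∈ B, a i ≤ 1 + k * (ε / 2) := by
    intro k
    induction k with
    | zero => exact ⟨∅, 0, by simp, by simp, by simp, by simp, by simp⟩
    | succ k ihk =>
      obtain ⟨s, a, hsN, ha, has, hsum, hB⟩ := ihk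
      set β : Ordinal.{0} := ((Finset.range (s.sup id + 1)).filter (ρ · < α)).sup ρ
      have hβ : β < α := (Finset.sup_lt_iff hα).2 fun c hc ↦ (Finset.mem_filter.1 hc).2
      obtain ⟨t, b, htN, hb, hbt, hsumt, hBt⟩ := ih β hβ (N ∩ Set.Ioi (s.sup id))
        (by
          have := hN.sdiff (Set.finite_Iic (s.sup id))
          refine this.mono fun i hi ↦ ⟨hi.1, ?_⟩
          simpa using hi.2) (ε / 2) (by positivity)
      have hst : ∀ i ∈ s, ∀ j ∈ t, i < j := fun i hi j hj ↦
        lt_of_le_of_lt (Finset.le_sup (f := id) hi) (htN j hj).2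
      have hdisj : Disjoint s t := Finset.disjoint_left.2 fun i hi hj ↦ (hst i hi i hj).false
      have hbs : ∀ i ∈ s, b i = 0 := fun i hi ↦ hbt i (Finset.disjoint_left.1 hdisj hi)
      have hat : ∀ i ∈ t, a i = 0 := fun i hi ↦ has i (Finset.disjoint_right.1 hdisj hi)
      refine ⟨s ∪ t, a + b, ?_, fun i ↦ add_nonneg (ha i) (hb i), ?_, ?_, ?_⟩
      · intro i hi
        rcases Finset.mem_union.1 hi with h | h
        exacts [hsN i h, (htN i h).1]
      · intro i hi
        simp only [Finset.mem_union, not_or] at hi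
        simp [has i hi.1, hbt i hi.2]
      · rw [Finset.sum_union hdisj, Finset.sum_congr rfl (fun i hi ↦ by
          rw [Pi.add_apply, hbs i hi, add_zero]), hsum, Finset.sum_congr rfl (g := b) (fun i hi ↦ by
          rw [Pi.add_apply, hat i hi, zero_add]), hsumt]
        push_cast; ring
      · intro B hBα
        have hsplit : ∑ i ∈ B, (a + b) i = ∑ i ∈ B, a i + ∑ i ∈ B, b i :=
          Finset.sum_add_distrib
        rw [hsplit]
        have hbB : ∑ i ∈ B, b i = ∑ i ∈ B ∩ t, b i :=
          (Finset.sum_subset Finset.inter_subset_left fun i hi hi' ↦ hbt i fun h ↦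
            hi' (Finset.mem_inter.2 ⟨hi, h⟩)).symm
        by_cases hne : (B ∩ s).Nonempty
        · obtain ⟨c, hc⟩ := hne
          obtain ⟨hcB, hcs⟩ := Finset.mem_inter.1 hc
          have h1 := hB B hBα
          obtain ⟨f, hf, hdec⟩ := hBα
          have hcβ : ρ (f c) ≤ β := Finset.le_sup (f := ρ) <| Finset.mem_filter.2
            ⟨Finset.mem_range_succ_iff.2 ((hf c hcB).1.trans (Finset.le_sup (f := id) hcs)),
              (hf c hcB).2⟩
          have h2 : ∑ i ∈ B ∩ t, b i ≤ ε / 2 := by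
            refine hBt _ ⟨f, fun i hi ↦ ?_, fun i hi j hj hij ↦ ?_⟩
            · obtain ⟨hiB, hit⟩ := Finset.mem_inter.1 hi
              exact ⟨(hf i hiB).1, (hdec c hcB i hiB (hst c hcs i hit)).trans_le hcβ⟩
            · exact hdec i (Finset.mem_inter.1 hi).1 j (Finset.mem_inter.1 hj).1 hij
          rw [hbB]
          push_cast
          linarith
        · have h1 : ∑ i ∈ B, a i = 0 := Finset.sum_eq_zero fun i hi ↦ has i fun h ↦
            hne ⟨i, Finset.mem_inter.2 ⟨hi, h⟩⟩
          have h2 : ∑ i ∈ B ∩ t, b i ≤ 1 := hsumt ▸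
            Finset.sum_le_sum_of_subset_of_nonneg Finset.inter_subset_right fun i _ _ ↦ hb i
          rw [h1, hbB]
          have : 0 ≤ ((k + 1 : ℕ) : ℝ) * (ε / 2) := by positivity
          linarith
  obtain ⟨k, hk⟩ := exists_nat_gt (2 / ε)
  have hk0 : (0 : ℝ) < k := lt_trans (by positivity) hk
  obtain ⟨s, a, hsN, ha, has, hsum, hB⟩ := key k
  refine ⟨s, fun i ↦ a i / k, hsN, fun i ↦ div_nonneg (ha i) hk0.le, fun i hi ↦ by
    simp [has i hi], by rw [← Finset.sum_div, hsum, div_self hk0.ne'], fun B hBα ↦ ?_⟩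
  rw [← Finset.sum_div, div_le_iff₀ hk0]
  have := hB B hBα
  rw [div_lt_iff₀ hε] at hk
  linarith

theorem weaklyNull_of_finite {X : Type*} [NormedAddCommGroup X] [NormedSpace ℝ X] {x : ℕ → X}
    (h : ∀ (φ : X →L[ℝ] ℝ) (δ : ℝ), 0 < δ → {n | δ ≤ φ (x n)}.Finite) : WeaklyNull x := by
  intro φ
  rw [Metric.tendsto_atTop']
  intro δ hδ
  obtain ⟨N, hN⟩ := ((h φ δ hδ).union (h (-φ) δ hδ)).bddAbove
  refine ⟨N, fun n hn ↦ ?_⟩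
  rw [dist_zero_right, Real.norm_eq_abs, abs_lt]
  by_contra hcon
  refine absurd (hN (?_ : n ∈ _)) (not_le.2 hn)
  rw [not_and_or, not_lt, not_lt] at hcon
  rcases hcon with h1 | h1
  · right
    change δ ≤ -(φ (x n))
    linarith
  · exact Or.inl h1

theorem WeaklyNull.exists_norm_le {X : Type*} [NormedAddCommGroup X] [NormedSpace ℝ X]
    {x : ℕ → X} (hx : WeaklyNull x) : ∃ L, ∀ n, ‖x n‖ ≤ L := by
  obtain ⟨L, hL⟩ := banach_steinhaus (g := fun n ↦ NormedSpace.inclusionInDoubleDual ℝ X (x n))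
    fun φ ↦ by
      obtain ⟨K, hK⟩ := (hx φ).norm.bddAbove_range
      exact ⟨K, fun n ↦ hK ⟨n, rfl⟩⟩
  refine ⟨L, fun n ↦ le_trans (le_of_eq ?_) (hL n)⟩
  exact ((NormedSpace.inclusionInDoubleDualLi ℝ (E := X)).norm_map (x n)).symm

/-- The successor relation of the tree of finite sets `A` such that some functional of norm at
most `m` is at least one on all `x n`, `n ∈ A`; nodes are pairs `(m, A)`. -/
def LowerEstimateRel {X : Type*} [NormedAddCommGroup X] [NormedSpace ℝ X] (x : ℕ → X)
    (s t : ℕ × Finset ℕ) : Prop :=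
  s.1 = t.1 ∧ t.2 ⊂ s.2 ∧ ∃ φ : X →L[ℝ] ℝ, ‖φ‖ ≤ s.1 ∧ ∀ n ∈ s.2, 1 ≤ φ (x n)

theorem WeaklyNull.wellFounded_lowerEstimateRel {X : Type*} [NormedAddCommGroup X]
    [NormedSpace ℝ X] {x : ℕ → X} (hx : WeaklyNull x) : WellFounded (LowerEstimateRel x) := by
  rw [wellFounded_iff_isEmpty_descending_chain]
  refine ⟨fun ⟨c, hc⟩ ↦ ?_⟩
  have hfst : ∀ i, (c i).1 = (c 0).1 := fun i ↦ by
    induction i with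
    | zero => rfl
    | succ i ih => exact (hc i).1.trans ih
  have hmono : StrictMono fun i ↦ (c i).2 := strictMono_nat_of_lt_succ fun i ↦ (hc i).2.1
  let K : ℕ → Set (WeakDual ℝ X) := fun i ↦
    WeakDual.toStrongDual ⁻¹' Metric.closedBall 0 ((c 0).1 : ℝ) ∩
      {φ | ∀ n ∈ (c (i + 1)).2, 1 ≤ φ (x n)}
  have hclosed : ∀ i, IsClosed {φ : WeakDual ℝ X | ∀ n ∈ (c (i + 1)).2, 1 ≤ φ (x n)} := fun i ↦ by
    simp only [Set.ofPred_forall]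
    exact isClosed_iInter fun n ↦ isClosed_iInter fun _ ↦
      isClosed_le continuous_const (WeakDual.eval_continuous (x n))
  obtain ⟨φ, hφ⟩ := IsCompact.nonempty_iInter_of_sequence_nonempty_isCompact_isClosed K
    (fun i φ hφ ↦ ⟨hφ.1, fun n hn ↦ hφ.2 n ((hmono.monotone (Nat.le_succ (i + 1))) hn)⟩)
    (fun i ↦ by
      obtain ⟨-, -, φ, hφ, hφx⟩ := hc i
      refine ⟨StrongDual.toWeakDual φ, ?_, hφx⟩
      rw [hfst] at hφ
      simpa using hφ)
    ((WeakDual.isCompact_closedBall 0 _).inter_right (hclosed 0))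
    (fun i ↦ (WeakDual.isClosed_closedBall 0 _).inter (hclosed i))
  have hone : ∀ i, ∀ n ∈ (c i).2, 1 ≤ φ (x n) := fun i n hn ↦
    (Set.mem_iInter.1 hφ i).2 n (hmono.monotone (Nat.le_succ i) hn)
  obtain ⟨N, hN⟩ := eventually_atTop.1
    ((hx (WeakDual.toStrongDual φ)).eventually (gt_mem_nhds one_pos))
  have hsub : ∀ i, (c i).2 ⊆ Finset.range N := fun i n hn ↦ by
    rw [Finset.mem_range]
    by_contra hcon
    exact absurd (hone i n hn) (not_le.2 (hN n (not_lt.1 hcon)))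
  exact (Set.infinite_range_of_injective hmono.injective)
    ((Finset.range N).powerset.finite_toSet.subset (by
      rintro _ ⟨i, rfl⟩
      exact Finset.mem_coe.2 (Finset.mem_powerset.2 (hsub i))))

open scoped ENNReal

theorem tendsto_lp_two_apply_atTop (v : lp (fun _ : ℕ ↦ ℝ) 2) : Tendsto (v ·) atTop (nhds 0) := by
  have h := ((lp.memℓp v).summable (by simp)).tendsto_atTop_zero
  simp only [ENNReal.toReal_ofNat, Real.rpow_ofNat, Real.norm_eq_abs, sq_abs] at h
  simpa [Real.sqrt_sq_eq_abs, tendsto_zero_iff_abs_tendsto_zero, Function.comp_def] using h.sqrt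

theorem hasSum_abs_pow_lp {p : ℝ≥0∞} {k : ℕ} (hk : p.toReal = k) (hk0 : k ≠ 0)
    (v : lp (fun _ : ℕ ↦ ℝ) p) : HasSum (fun i ↦ |v i| ^ k) (‖v‖ ^ k) := by
  have h := lp.hasSum_norm (by rw [hk]; positivity) v
  simpa only [hk, Real.rpow_natCast, Real.norm_eq_abs] using h

instance fact_one_le_four : Fact ((1 : ℝ≥0∞) ≤ 4) := ⟨by norm_num⟩

theorem norm_linearMapOfLE_pow_four_le {v : lp (fun _ : ℕ ↦ ℝ) 2} {δ : ℝ}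
    (hδ : ∀ i, |v i| ≤ δ) :
    ‖lp.linearMapOfLE ℝ (fun _ : ℕ ↦ ℝ) (show (2 : ℝ≥0∞) ≤ 4 by norm_num) v‖ ^ 4
      ≤ δ ^ 2 * ‖v‖ ^ 2 := by
  have h2 : HasSum (fun i ↦ |v i| ^ 2) (‖v‖ ^ 2) := hasSum_abs_pow_lp (by simp) two_ne_zero v
  refine hasSum_le (fun i ↦ ?_) (hasSum_abs_pow_lp (by simp) four_ne_zero
    (lp.linearMapOfLE ℝ (fun _ : ℕ ↦ ℝ) (show (2 : ℝ≥0∞) ≤ 4 by norm_num) v)) (h2.mul_left (δ ^ 2))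
  rw [lp.coe_linearMapOfLE_apply]
  have : |v i| ^ 2 ≤ δ ^ 2 := pow_le_pow_left₀ (abs_nonneg _) (hδ i) 2
  nlinarith [sq_nonneg |v i|]

/-- The inclusion of `ℓ²` into `ℓ⁴`. -/
noncomputable def lpTwoToFour : lp (fun _ : ℕ ↦ ℝ) 2 →L[ℝ] lp (fun _ : ℕ ↦ ℝ) 4 :=
  (lp.linearMapOfLE ℝ (fun _ : ℕ ↦ ℝ) (show (2 : ℝ≥0∞) ≤ 4 by norm_num)).mkContinuous 1 fun v ↦ by
    rw [one_mul]
    refine le_of_pow_le_pow_left₀ four_ne_zero (norm_nonneg v)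
      ((norm_linearMapOfLE_pow_four_le fun i ↦ lp.norm_apply_le_norm two_ne_zero v i).trans_eq ?_)
    ring

theorem weaklyNull_evalCLM_lp_four :
    WeaklyNull fun n ↦ lp.evalCLM ℝ (fun _ : ℕ ↦ ℝ) (4 : ℝ≥0∞) n := by
  refine weaklyNull_of_finite fun φ δ hδ ↦ ?_
  by_contra hinf
  obtain ⟨q, hq⟩ := exists_nat_gt (‖φ‖ ^ 4 / δ ^ 4)
  obtain ⟨s, hs, hcard⟩ := Set.Infinite.exists_subset_card_eq hinf q
  have hq0 : (0 : ℝ) < q := lt_of_le_of_lt (by positivity) hq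
  set R := ∑ n ∈ s, lp.evalCLM ℝ (fun _ : ℕ ↦ ℝ) (4 : ℝ≥0∞) n with hR
  obtain ⟨r, hr0, hr⟩ : ∃ r : ℝ, 0 ≤ r ∧ r ^ 4 = q ^ 3 :=
    ⟨((q : ℝ) ^ 3) ^ (4⁻¹ : ℝ), by positivity, by
      rw [← Real.rpow_natCast, ← Real.rpow_mul (by positivity)]; norm_num⟩
  have hRn : ‖R‖ ≤ r := by
    refine R.opNorm_le_bound hr0 fun v ↦ ?_
    refine le_of_pow_le_pow_left₀ four_ne_zero (by positivity) ?_
    have h1 : ‖R v‖ ≤ ∑ n ∈ s, |v n| := by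
      simp only [hR, sum_apply]
      exact norm_sum_le _ _
    have h2 := pow_sum_div_card_le_sum_pow (s := s) (f := fun n ↦ |v n|) (fun i _ ↦ abs_nonneg _) 3
    have h3 : ∑ n ∈ s, |v n| ^ 4 ≤ ‖v‖ ^ 4 :=
      sum_le_hasSum s (fun _ _ ↦ by positivity) (hasSum_abs_pow_lp (by simp) four_ne_zero v)
    rw [hcard, div_le_iff₀ (by positivity)] at h2
    calc ‖R v‖ ^ 4 ≤ (∑ n ∈ s, |v n|) ^ 4 := by gcongr
      _ ≤ (∑ n ∈ s, |v n| ^ 4) * q ^ 3 := h2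
      _ ≤ ‖v‖ ^ 4 * q ^ 3 := by gcongr
      _ = (r * ‖v‖) ^ 4 := by rw [mul_pow, hr]; ring
  have hφR : q * δ ≤ ‖φ‖ * r := by
    calc q * δ = ∑ n ∈ s, δ := by simp [hcard]
      _ ≤ ∑ n ∈ s, φ (lp.evalCLM ℝ (fun _ : ℕ ↦ ℝ) (4 : ℝ≥0∞) n) :=
          Finset.sum_le_sum fun n hn ↦ hs hn
      _ = φ R := by rw [hR, map_sum]
      _ ≤ ‖φ‖ * ‖R‖ := (le_abs_self _).trans (φ.le_opNorm R)
      _ ≤ ‖φ‖ * r := by gcongr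
  have h4 : (q * δ) ^ 4 ≤ (‖φ‖ * r) ^ 4 := by gcongr
  rw [mul_pow, mul_pow, hr] at h4
  rw [div_lt_iff₀ (by positivity)] at hq
  have : ‖φ‖ ^ 4 * (q : ℝ) ^ 3 < (q * δ ^ 4) * q ^ 3 := by gcongr
  linarith [show (q : ℝ) ^ 4 * δ ^ 4 = (q * δ ^ 4) * q ^ 3 by ring]

/-- The space of all `v ∈ ℓ²` whose sums over the members of `𝓕` are bounded, realised as the
subspace of `ℓ^∞(𝓕) × ℓ²` of pairs `(u, v)` in which `u` is the family of these sums. -/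
noncomputable def sumSpace (𝓕 : Set (Finset ℕ)) :
    Submodule ℝ (lp (fun _ : 𝓕 ↦ ℝ) ∞ × lp (fun _ : ℕ ↦ ℝ) 2) where
  carrier := {z | ∀ B : 𝓕, z.1 B = ∑ i ∈ B.1, z.2 i}
  add_mem' {y z} hy hz B := by
    simp only [Prod.fst_add, Prod.snd_add, lp.coeFn_add, Pi.add_apply, hy B, hz B,
      Finset.sum_add_distrib]
  zero_mem' B := by simp
  smul_mem' c z hz B := by
    simp only [Prod.smul_fst, Prod.smul_snd, lp.coeFn_smul, Pi.smul_apply, hz B, Finset.smul_sum]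

theorem isClosed_sumSpace (𝓕 : Set (Finset ℕ)) :
    IsClosed (sumSpace 𝓕 : Set (lp (fun _ : 𝓕 ↦ ℝ) ∞ × lp (fun _ : ℕ ↦ ℝ) 2)) := by
  change IsClosed {z : lp (fun _ : 𝓕 ↦ ℝ) ∞ × lp (fun _ : ℕ ↦ ℝ) 2 |
    ∀ B : 𝓕, z.1 B = ∑ i ∈ B.1, z.2 i}
  simp only [Set.ofPred_forall]
  exact isClosed_iInter fun B ↦ isClosed_eq
    ((lp.evalCLM ℝ (fun _ : 𝓕 ↦ ℝ) ∞ B).continuous.comp continuous_fst)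
    (continuous_finsetSum _ fun i _ ↦
      (lp.evalCLM ℝ (fun _ : ℕ ↦ ℝ) 2 i).continuous.comp continuous_snd)

instance completeSpace_sumSpace (𝓕 : Set (Finset ℕ)) : CompleteSpace (sumSpace 𝓕) :=
  (isClosed_sumSpace 𝓕).completeSpace_coe

namespace sumSpace

/-- The projection of `sumSpace 𝓕` to `ℓ²`. -/
noncomputable def toLpTwo (𝓕 : Set (Finset ℕ)) : sumSpace 𝓕 →L[ℝ] lp (fun _ : ℕ ↦ ℝ) 2 :=
  (ContinuousLinearMap.snd ℝ _ _).comp (sumSpace 𝓕).subtypeL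

/-- The sum over a member of `𝓕`, as a functional on `sumSpace 𝓕`. -/
noncomputable def sumCLM {𝓕 : Set (Finset ℕ)} (B : 𝓕) : sumSpace 𝓕 →L[ℝ] ℝ :=
  (lp.evalCLM ℝ (fun _ : 𝓕 ↦ ℝ) ∞ B).comp
    ((ContinuousLinearMap.fst ℝ _ _).comp (sumSpace 𝓕).subtypeL)

theorem sumCLM_apply {𝓕 : Set (Finset ℕ)} (B : 𝓕) (z : sumSpace 𝓕) :
    sumCLM B z = ∑ i ∈ B.1, toLpTwo 𝓕 z i :=
  z.2 B

theorem norm_toLpTwo_apply_le {𝓕 : Set (Finset ℕ)} (z : sumSpace 𝓕) : ‖toLpTwo 𝓕 z‖ ≤ ‖z‖ :=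
  norm_snd_le z.1

theorem norm_sumCLM_apply_le {𝓕 : Set (Finset ℕ)} (B : 𝓕) (z : sumSpace 𝓕) :
    ‖sumCLM B z‖ ≤ ‖z‖ :=
  (lp.norm_apply_le_norm ENNReal.top_ne_zero z.1.1 B).trans (norm_fst_le z.1)

theorem norm_le {𝓕 : Set (Finset ℕ)} {z : sumSpace 𝓕} {C : ℝ} (hC : 0 ≤ C)
    (h1 : ∀ B : 𝓕, |∑ i ∈ B.1, toLpTwo 𝓕 z i| ≤ C) (h2 : ‖toLpTwo 𝓕 z‖ ≤ C) : ‖z‖ ≤ C :=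
  (norm_prod_le_iff (x := z.1)).2 ⟨lp.norm_le_of_forall_le hC fun B ↦ by
    rw [z.2 B]; exact h1 B, h2⟩

/-- The unit vectors of `sumSpace 𝓕`. -/
noncomputable def unitVec (𝓕 : Set (Finset ℕ)) (n : ℕ) : sumSpace 𝓕 :=
  ⟨(⟨fun B ↦ if n ∈ B.1 then 1 else 0, memℓp_infty ⟨1, by
      rintro _ ⟨B, rfl⟩
      dsimp only
      split_ifs <;> simp⟩⟩, lp.single 2 n 1), fun B ↦ by
    simp [Pi.single_apply]⟩

theorem toLpTwo_unitVec (𝓕 : Set (Finset ℕ)) (n : ℕ) :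
    toLpTwo 𝓕 (unitVec 𝓕 n) = lp.single 2 n 1 := rfl

theorem toLpTwo_sum_smul_unitVec (𝓕 : Set (Finset ℕ)) (s : Finset ℕ) (a : ℕ → ℝ) :
    toLpTwo 𝓕 (∑ i ∈ s, a i • unitVec 𝓕 i) = ∑ i ∈ s, lp.single 2 i (a i) := by
  rw [map_sum]
  refine Finset.sum_congr rfl fun i _ ↦ ?_
  rw [map_smul, toLpTwo_unitVec, ← lp.single_smul, smul_eq_mul, mul_one]

theorem weaklyNull_unitVec {ρ : ℕ → Ordinal.{0}} {α : Ordinal.{0}} (hα : ∀ c, ρ c < α) :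
    WeaklyNull (unitVec {B | RankAdmissible ρ α B}) := by
  set 𝓕 := {B | RankAdmissible ρ α B}
  refine weaklyNull_of_finite fun φ δ hδ ↦ ?_
  by_contra hinf
  obtain ⟨η, hη0, hη1, hη⟩ : ∃ η : ℝ, 0 < η ∧ η ≤ 1 ∧ ‖φ‖ * η < δ := by
    refine ⟨min 1 (δ / (‖φ‖ + 1)), by positivity, min_le_left _ _, ?_⟩
    calc ‖φ‖ * min 1 (δ / (‖φ‖ + 1)) ≤ ‖φ‖ * (δ / (‖φ‖ + 1)) := by gcongr; exact min_le_right _ _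
      _ < δ := by
        rw [mul_div_assoc', div_lt_iff₀ (by positivity)]
        nlinarith
  obtain ⟨s, a, hsN, ha, has, hsum, hB⟩ :=
    RankAdmissible.exists_convex_combination ρ α _ hinf (η ^ 2) (by positivity)
  have hsingle : ∀ i, a i ≤ η ^ 2 := fun i ↦ by
    simpa using hB {i} ⟨fun _ ↦ 0, fun b _ ↦ ⟨Nat.zero_le b, hα 0⟩, fun b hb b' hb' h ↦ by
      simp only [Finset.mem_singleton] at hb hb'
      omega⟩
  set y := ∑ i ∈ s, a i • unitVec 𝓕 i with hy
  have hy2 : toLpTwo 𝓕 y = ∑ i ∈ s, lp.single 2 i (a i) := toLpTwo_sum_smul_unitVec 𝓕 s a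
  have hyi : ∀ i, toLpTwo 𝓕 y i = a i := fun i ↦ by
    rw [hy2, lp.coeFn_sum, Finset.sum_apply]
    simp only [lp.coeFn_single, Finset.sum_pi_single]
    split_ifs with h
    exacts [rfl, (has i h).symm]
  have hyn : ‖y‖ ≤ η := by
    refine norm_le hη0.le (fun B ↦ ?_) ?_
    · simp only [hyi]
      rw [abs_of_nonneg (Finset.sum_nonneg fun i _ ↦ ha i)]
      exact (hB B.1 B.2).trans (by nlinarith)
    · rw [hy2]
      refine le_of_pow_le_pow_left₀ two_ne_zero hη0.le ?_
      have h := lp.norm_sum_single (p := 2) (by simp) a s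
      simp only [ENNReal.toReal_ofNat, Real.rpow_ofNat, Real.norm_eq_abs, sq_abs] at h
      rw [h]
      calc ∑ i ∈ s, a i ^ 2 ≤ ∑ i ∈ s, η ^ 2 * a i := Finset.sum_le_sum fun i _ ↦ by
            nlinarith [hsingle i, ha i]
        _ = η ^ 2 := by rw [← Finset.mul_sum, hsum, mul_one]
  have h1 : δ ≤ φ y := by
    calc δ = ∑ i ∈ s, a i * δ := by rw [← Finset.sum_mul, hsum, one_mul]
      _ ≤ ∑ i ∈ s, a i * φ (unitVec 𝓕 i) :=
          Finset.sum_le_sum fun i hi ↦ mul_le_mul_of_nonneg_left (hsN i hi) (ha i)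
      _ = φ y := by simp [hy, map_sum]
  have h2 : φ y ≤ ‖φ‖ * η := (le_abs_self _).trans ((φ.le_opNorm y).trans (by gcongr))
  linarith

/-- The inclusion of `sumSpace 𝓕` into `ℓ⁴`. -/
noncomputable def toLpFour (𝓕 : Set (Finset ℕ)) : sumSpace 𝓕 →L[ℝ] lp (fun _ : ℕ ↦ ℝ) 4 :=
  lpTwoToFour.comp (toLpTwo 𝓕)

theorem not_dunfordPettis_toLpFour {ρ : ℕ → Ordinal.{0}} {α : Ordinal.{0}} (hα : ∀ c, ρ c < α) :
    ¬ DunfordPettis (toLpFour {B | RankAdmissible ρ α B}) := by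
  intro h
  have h1 := h _ _ (weaklyNull_unitVec hα) weaklyNull_evalCLM_lp_four
  have h2 : ∀ n, lp.evalCLM ℝ (fun _ : ℕ ↦ ℝ) (4 : ℝ≥0∞) n
      (toLpFour {B | RankAdmissible ρ α B} (unitVec {B | RankAdmissible ρ α B} n)) = 1 := fun n ↦
    lp.single_apply_self (E := fun _ : ℕ ↦ ℝ) 2 n 1
  simp only [h2] at h1
  exact one_ne_zero (tendsto_nhds_unique tendsto_const_nhds h1)

end sumSpace

theorem WellFounded.exists_ordinal_coding {ι : Type} [Encodable ι] [Nonempty ι] {r : ι → ι → Prop}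
    (hr : WellFounded r) : ∃ (ρ : ℕ → Ordinal.{0}) (α : Ordinal.{0}) (code : ι → ℕ),
      (∀ c, ρ c < α) ∧ ∀ s t, r s t → ρ (code s) < ρ (code t) := by
  have : IsWellFounded ι r := ⟨hr⟩
  let ρ : ℕ → Ordinal.{0} := fun c ↦
    IsWellFounded.rank r ((Encodable.decode c).getD (Classical.arbitrary ι))
  refine ⟨ρ, Order.succ (⨆ c, ρ c), Encodable.encode, fun c ↦
    Order.lt_succ_of_le (Ordinal.le_iSup ρ c), fun s t hst ↦ ?_⟩
  simpa [ρ] using IsWellFounded.rank_lt_of_rel hst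

namespace sumSpace

variable {X : Type*} [NormedAddCommGroup X] [NormedSpace ℝ X] {x : ℕ → X}
  {ρ : ℕ → Ordinal.{0}} {α : Ordinal.{0}} {code : ℕ × Finset ℕ → ℕ}

/-- If the ranks `ρ` dominate the tree of lower `ℓ¹` estimates of the weakly null sequence `x`,
then the coordinates of the image of `x` in `sumSpace` tend to zero uniformly from above. -/
theorem finite_le_coord (hx : WeaklyNull x) (hα : ∀ c, ρ c < α)
    (hcode : ∀ s t, LowerEstimateRel x s t → ρ (code s) < ρ (code t))
    {𝓕 : Set (Finset ℕ)} (h𝓕 : {B | RankAdmissible ρ α B} ⊆ 𝓕) (C : X →L[ℝ] sumSpace 𝓕) {δ : ℝ}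
    (hδ : 0 < δ) : {n | ∃ i, δ ≤ toLpTwo 𝓕 (C (x n)) i}.Finite := by
  set v : ℕ → lp (fun _ : ℕ ↦ ℝ) 2 := fun n ↦ toLpTwo 𝓕 (C (x n)) with hv
  by_contra hinf
  set M := {n | ∃ i, δ ≤ v n i}
  have hex : ∀ n, ∃ i, n ∈ M → δ ≤ v n i := fun n ↦ by
    by_cases h : n ∈ M
    · exact ⟨h.choose, fun _ ↦ h.choose_spec⟩
    · exact ⟨0, fun h' ↦ absurd h' h⟩
  choose k hk using hex
  have hcoord : ∀ i, Tendsto (fun n ↦ v n i) atTop (nhds 0) := fun i ↦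
    hx ((lp.evalCLM ℝ (fun _ : ℕ ↦ ℝ) 2 i).comp ((toLpTwo 𝓕).comp C))
  set l : Filter ℕ := atTop ⊓ 𝓟 M with hl
  have hlne : l.NeBot := by
    rw [hl, ← frequently_mem_iff_neBot]
    exact Nat.frequently_atTop_iff_infinite.2 hinf
  have hkl : Tendsto k l atTop := by
    refine tendsto_atTop.2 fun K ↦ ?_
    have h1 : ∀ᶠ n in atTop, ∀ i ∈ Finset.range K, v n i < δ :=
      (Finset.eventually_all _).2 fun i _ ↦ (hcoord i).eventually (gt_mem_nhds hδ)
    refine eventually_inf_principal.2 (h1.mono fun n hn hnM ↦ ?_)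
    by_contra hcon
    exact absurd (hk n hnM) (not_le.2 (hn _ (Finset.mem_range.2 (not_le.1 hcon))))
  obtain ⟨m, hm⟩ := exists_nat_ge (2 / δ * ‖C‖)
  have key : ∀ t : ℕ × Finset ℕ, t.1 = m → Set.InjOn k t.2 →
      (∀ n ∈ t.2, δ / 2 < ∑ j ∈ t.2, v n (k j)) →
      (∃ f : ℕ → ℕ, (∀ b ∈ t.2.image k, f b ≤ b ∧ ρ (code t) < ρ (f b)) ∧
        ∀ b ∈ t.2.image k, ∀ b' ∈ t.2.image k, b < b' → ρ (f b') < ρ (f b)) → False := by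
    intro t
    induction t using hx.wellFounded_lowerEstimateRel.induction with
    | h t ih =>
    obtain ⟨m', A⟩ := t
    rintro rfl hinj hsum ⟨f, hf, hdec⟩
    dsimp only at hinj hsum hf hdec hm
    have e1 : ∀ᶠ n in l, n ∈ M := mem_inf_of_right (mem_principal_self M)
    have e2 : ∀ᶠ n in l, code (m', A) ≤ k n := hkl.eventually_ge_atTop _
    have e3 : ∀ᶠ n in l, (A.image k).sup id < k n := hkl.eventually_gt_atTop _
    have e4 : ∀ᶠ n in l, ∀ i ∈ A, δ / 2 < ∑ j ∈ A, v i (k j) + v i (k n) :=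
      (Finset.eventually_all _).2 fun i hi ↦ by
        have : Tendsto (fun n ↦ ∑ j ∈ A, v i (k j) + v i (k n)) l
            (nhds (∑ j ∈ A, v i (k j) + 0)) :=
          tendsto_const_nhds.add ((tendsto_lp_two_apply_atTop (v i)).comp hkl)
        rw [add_zero] at this
        exact this.eventually (lt_mem_nhds (hsum i hi))
    have e5 : ∀ᶠ n in l, -(δ / 2) < ∑ j ∈ A, v n (k j) := by
      have : Tendsto (fun n ↦ ∑ j ∈ A, v n (k j)) l (nhds (∑ j ∈ A, 0)) :=
        (tendsto_finsetSum _ fun j _ ↦ hcoord (k j)).mono_left inf_le_left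
      rw [Finset.sum_const_zero] at this
      exact this.eventually (lt_mem_nhds (by linarith))
    obtain ⟨n, hnM, hncode, hnsup, hnA, hnn⟩ :=
      (e1.and (e2.and (e3.and (e4.and e5)))).exists
    have hlt : ∀ b ∈ A.image k, b < k n := fun b hb ↦
      lt_of_le_of_lt (Finset.le_sup (f := id) hb) hnsup
    have hkn : k n ∉ A.image k := fun h ↦ (hlt _ h).false
    have hn : n ∉ A := fun h ↦ hkn (Finset.mem_image_of_mem k h)
    set g := Function.update f (k n) (code (m', A)) with hg
    have hgn : g (k n) = code (m', A) := Function.update_self ..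
    have hgA : ∀ b ∈ A.image k, g b = f b := fun b hb ↦
      Function.update_of_ne (hlt b hb).ne _ _
    have hgle : ∀ b ∈ (insert n A).image k, g b ≤ b ∧ ρ (code (m', A)) ≤ ρ (g b) := by
      intro b hb
      rw [Finset.image_insert, Finset.mem_insert] at hb
      rcases hb with rfl | hb
      · exact ⟨hgn ▸ hncode, hgn ▸ le_rfl⟩
      · rw [hgA b hb]
        exact ⟨(hf b hb).1, (hf b hb).2.le⟩
    have hgdec : ∀ b ∈ (insert n A).image k, ∀ b' ∈ (insert n A).image k, b < b' →
        ρ (g b') < ρ (g b) := by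
      intro b hb b' hb' hbb'
      rw [Finset.image_insert, Finset.mem_insert] at hb hb'
      rcases hb with rfl | hb
      · rcases hb' with rfl | hb'
        · exact absurd hbb' (lt_irrefl _)
        · exact absurd (hlt b' hb') hbb'.not_gt
      · rcases hb' with rfl | hb'
        · rw [hgn, hgA b hb]
          exact (hf b hb).2
        · rw [hgA b hb, hgA b' hb']
          exact hdec b hb b' hb' hbb'
    have hB : (insert n A).image k ∈ 𝓕 :=
      h𝓕 ⟨g, fun b hb ↦ ⟨(hgle b hb).1, hα _⟩, hgdec⟩
    have hinj' : Set.InjOn k (insert n A : Finset ℕ) := by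
      rw [Finset.coe_insert, Set.injOn_insert (by simpa using hn)]
      exact ⟨hinj, by simpa using hkn⟩
    have hsum' : ∀ i ∈ insert n A, δ / 2 < ∑ j ∈ insert n A, v i (k j) := by
      intro i hi
      rw [Finset.sum_insert hn]
      rcases Finset.mem_insert.1 hi with rfl | hi
      · linarith [hk i hnM]
      · linarith [hnA i hi]
    have hrel : LowerEstimateRel x (m', insert n A) (m', A) := by
      refine ⟨rfl, Finset.ssubset_insert hn, (2 / δ) • (sumCLM ⟨_, hB⟩).comp C, ?_, fun i hi ↦ ?_⟩
      · refine le_trans ?_ hm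
        rw [norm_smul, Real.norm_of_nonneg (by positivity)]
        gcongr
        exact ContinuousLinearMap.opNorm_le_bound _ (norm_nonneg C) fun y ↦
          (norm_sumCLM_apply_le _ _).trans (C.le_opNorm y)
      · have h := hsum' i hi
        rw [← Finset.sum_image (f := fun j ↦ v i j) hinj'] at h
        change 1 ≤ 2 / δ * sumCLM ⟨_, hB⟩ (C (x i))
        rw [sumCLM_apply, div_mul_eq_mul_div, le_div_iff₀ hδ]
        linarith
    exact ih _ hrel rfl hinj' hsum' ⟨g, fun b hb ↦
      ⟨(hgle b hb).1, (hcode _ _ hrel).trans_le (hgle b hb).2⟩, hgdec⟩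
  exact key (m, ∅) rfl (by simp) (by simp) ⟨id, by simp, by simp⟩

theorem tendsto_norm_toLpFour (hx : WeaklyNull x) (hα : ∀ c, ρ c < α)
    (hcode : ∀ s t, LowerEstimateRel x s t → ρ (code s) < ρ (code t))
    (C : X →L[ℝ] sumSpace {B | RankAdmissible ρ α B}) :
    Tendsto (fun n ↦ ‖toLpFour _ (C (x n))‖) atTop (nhds 0) := by
  obtain ⟨L, hL⟩ := hx.exists_norm_le
  have hL0 : 0 ≤ L := (norm_nonneg _).trans (hL 0)
  set K := ‖C‖ * L + 1 with hK
  have hK0 : 0 < K := by positivity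
  have hvK : ∀ n, ‖toLpTwo _ (C (x n))‖ ≤ K := fun n ↦ by
    calc _ ≤ ‖C (x n)‖ := norm_toLpTwo_apply_le _
      _ ≤ ‖C‖ * ‖x n‖ := C.le_opNorm _
      _ ≤ ‖C‖ * L := by gcongr; exact hL n
      _ ≤ K := by linarith
  rw [Metric.tendsto_atTop']
  intro η hη
  have hδ : 0 < η ^ 2 / (2 * K) := by positivity
  obtain ⟨N, hN⟩ := ((finite_le_coord hx hα hcode subset_rfl C hδ).union
    (finite_le_coord hx hα hcode subset_rfl (-C) hδ)).bddAbove
  refine ⟨N, fun n hn ↦ ?_⟩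
  rw [dist_zero_right, norm_norm]
  have hsmall : ∀ i, |toLpTwo _ (C (x n)) i| ≤ η ^ 2 / (2 * K) := fun i ↦ by
    by_contra hcon
    refine absurd (hN (?_ : n ∈ _)) (not_le.2 hn)
    rw [not_le, lt_abs] at hcon
    rcases hcon with h | h
    · exact Or.inl ⟨i, h.le⟩
    · refine Or.inr ⟨i, ?_⟩
      rw [neg_apply, map_neg]
      exact h.le
  refine lt_of_pow_lt_pow_left₀ 4 hη.le ((norm_linearMapOfLE_pow_four_le hsmall).trans_lt ?_)
  calc (η ^ 2 / (2 * K)) ^ 2 * ‖toLpTwo _ (C (x n))‖ ^ 2 ≤ (η ^ 2 / (2 * K)) ^ 2 * K ^ 2 := by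
        gcongr; exact hvK n
    _ = η ^ 4 / 4 := by field_simp; ring
    _ < η ^ 4 := by linarith [pow_pos hη 4]

end sumSpace

theorem statement8 :
    ¬ ∃ (E F : BanachSp) (U : E.carrier →L[ℝ] F.carrier),
      ¬ DunfordPettis U ∧
        ∀ (Z W : BanachSp) (T : Z.carrier →L[ℝ] W.carrier),
          ¬ DunfordPettis T → FactorsThrough U T := by
  rintro ⟨E, F, U, hU, hfac⟩
  refine hU fun x g hx hg ↦ ?_
  obtain ⟨ρ, α, code, hα, hcode⟩ := hx.wellFounded_lowerEstimateRel.exists_ordinal_coding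
  obtain ⟨C, D, hCD⟩ := hfac ⟨sumSpace {B | RankAdmissible ρ α B}⟩ ⟨lp (fun _ : ℕ ↦ ℝ) 4⟩ _
    (sumSpace.not_dunfordPettis_toLpFour hα)
  obtain ⟨G, hG⟩ := hg.exists_norm_le
  have hG0 : 0 ≤ G := (norm_nonneg _).trans (hG 0)
  have hlim := (sumSpace.tendsto_norm_toLpFour hx hα hcode C).const_mul (G * ‖D‖)
  rw [mul_zero] at hlim
  refine squeeze_zero_norm (fun n ↦ ?_) hlim
  rw [← hCD (x n), mul_assoc]
  exact (g n).le_of_opNorm_le_of_le (hG n) (D.le_opNorm _)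
end
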